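/- There exist constants C0 > 0, c > 0, C > 0 and N such that for every n ≥ N divisible by 3 and every p with n·p ≥ C0, a sample G ~ 𝒢_{n,p,3} satisfies the following with probability at least 1 − e^{−c·n·p}: for every 3-coloring φ : V → Fin 3 with |{v : φ(v) ≠ φ*(v)}| ≤ n/120, the Gallager iteration on G started from φ converges at some iteration T ≤ C·log n; moreover, letting V_A = {v ∈ V : B(v, m^T) = some(φ*(v))}, one has |V_A| ≥ (1 − e^{−c·n·p})·n, B(v, m^T) = none for every v ∈ V ∖ V_A, and there exists a proper 3-coloring ψ of G with ψ(v) = φ*(v) for all v ∈ V_A. -/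

import Mathlib

open MeasureTheory

/-- The balanced planted 3-coloring on `Fin n`: vertex `v` gets color `v mod 3`. -/
def plantedColoring (n : ℕ) (v : Fin n) : Fin 3 := ⟨v.val % 3, Nat.mod_lt _ (by norm_num)⟩

/-- A pair of vertices is bichromatic if its two endpoints get distinct planted colors. -/
def Bichrom (n : ℕ) (e : Sym2 (Fin n)) : Prop :=
  Sym2.lift ⟨fun u v => plantedColoring n u ≠ plantedColoring n v,
    fun u v => propext ne_comm⟩ e

/-- The type of bichromatic pairs. -/
abbrev BichromPair (n : ℕ) : Type := {e : Sym2 (Fin n) // Bichrom n e}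

noncomputable instance (n : ℕ) : Fintype (BichromPair n) := Fintype.ofFinite _

/-- The Bernoulli measure on `Bool` with parameter `p`. -/
noncomputable def bernoulliMeasure (p : ℝ) : Measure Bool :=
  ENNReal.ofReal p • Measure.dirac true + ENNReal.ofReal (1 - p) • Measure.dirac false

/-- The planted 3-coloring distribution `𝒢_{n,p,3}`: the product over all bichromatic
pairs of Bernoulli(p) measures on `Bool`. -/
noncomputable def plantedMeasure (n : ℕ) (p : ℝ) : Measure (BichromPair n → Bool) :=
  Measure.pi fun _ => bernoulliMeasure p

/-- The graph of a sample point `ω`: its edges are the bichromatic pairs `e` with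
`ω e = true`. -/
def plantedGraph (n : ℕ) (ω : BichromPair n → Bool) : SimpleGraph (Fin n) :=
  SimpleGraph.fromEdgeSet {e : Sym2 (Fin n) | ∃ h : Bichrom n e, ω ⟨e, h⟩ = true}

/-- `e(S)`: the number of edges of `G` with both endpoints in `S`. -/
noncomputable def edgeCount {V : Type*} (G : SimpleGraph V) (S : Set V) : ℕ :=
  {e : Sym2 V | e ∈ G.edgeSet ∧ ∀ v ∈ e, v ∈ S}.ncard

/-- `D` is a `d`-core: every `v ∈ D` has at least `d/5` neighbors in `D ∩ V_i` for
each color class index `i ≠ φ*(v)`, and at most `d/20` neighbors outside `D`. -/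
def IsCore (n : ℕ) (G : SimpleGraph (Fin n)) (d : ℝ) (D : Set (Fin n)) : Prop :=
  ∀ v ∈ D,
    (∀ i : Fin 3, i ≠ plantedColoring n v →
      d / 5 ≤ ({w : Fin n | G.Adj v w ∧ w ∈ D ∧ plantedColoring n w = i}.ncard : ℝ)) ∧
    ({w : Fin n | G.Adj v w ∧ w ∉ D}.ncard : ℝ) ≤ d / 20

/-- `c_t(u,v,m)`: the number of neighbors `w` of `u` other than `v` with `m(w→u) = some t`. -/
noncomputable def msgCount {V : Type*} (G : SimpleGraph V)
    (m : V → V → Option (Fin 3)) (u v : V) (t : Fin 3) : ℕ :=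
  {w : V | G.Adj u w ∧ w ≠ v ∧ m w u = some t}.ncard

/-- The smallest color minimizing `f`. -/
def argminFin3 (f : Fin 3 → ℕ) : Fin 3 :=
  if f 0 ≤ f 1 ∧ f 0 ≤ f 2 then 0 else if f 1 ≤ f 2 then 1 else 2

open Classical in
/-- Gallager update (threshold τ = 1): `U(m)(u→v) = none` if at least two distinct colors
have count 0, otherwise the smallest color minimizing the count. -/
noncomputable def gallagerUpdate {V : Type*} (G : SimpleGraph V)
    (m : V → V → Option (Fin 3)) : V → V → Option (Fin 3) := fun u v =>
  if ∃ t₁ t₂ : Fin 3, t₁ ≠ t₂ ∧ msgCount G m u v t₁ = 0 ∧ msgCount G m u v t₂ = 0 then none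
  else some (argminFin3 (msgCount G m u v))

/-- The number of neighbors `w` of `u` with `m(w→u) = some t`. -/
noncomputable def outCount {V : Type*} (G : SimpleGraph V)
    (m : V → V → Option (Fin 3)) (u : V) (t : Fin 3) : ℕ :=
  {w : V | G.Adj u w ∧ m w u = some t}.ncard

open Classical in
/-- Output `B(u, m)` of a message state at a vertex `u`. -/
noncomputable def gallagerOutput {V : Type*} (G : SimpleGraph V)
    (m : V → V → Option (Fin 3)) (u : V) : Option (Fin 3) :=
  if ∃ t₁ t₂ : Fin 3, t₁ ≠ t₂ ∧ outCount G m u t₁ = 0 ∧ outCount G m u t₂ = 0 then none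
  else some (argminFin3 (outCount G m u))

/-- The Gallager iterates: `m⁰(u→v) = some (φ u)`, `mⁱ⁺¹ = U(mⁱ)`. -/
noncomputable def gallagerIter {V : Type*} (G : SimpleGraph V) (φ : V → Fin 3) :
    ℕ → V → V → Option (Fin 3)
  | 0 => fun u _ => some (φ u)
  | i + 1 => gallagerUpdate G (gallagerIter G φ i)

section SparseGraphs

variable {V : Type*}

open Classical in
/-- The neighbors of `v` inside `A`. -/
noncomputable def nbrsIn (G : SimpleGraph V) (v : V) (A : Finset V) : Finset V :=
  A.filter fun w => G.Adj v w

lemma mem_nbrsIn {G : SimpleGraph V} {v w : V} {A : Finset V} :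
    w ∈ nbrsIn G v A ↔ w ∈ A ∧ G.Adj v w := by
  simp [nbrsIn]

variable [DecidableEq V]

/-- The unordered pairs of distinct elements of `U`. -/
def pairsIn (U : Finset V) : Finset (Sym2 V) := U.offDiag.image (Function.uncurry Sym2.mk)

open Classical in
/-- The edges of `G` with both endpoints in `U`. -/
noncomputable def edgesIn (G : SimpleGraph V) (U : Finset V) : Finset (Sym2 V) :=
  (pairsIn U).filter fun e => e ∈ G.edgeSet

lemma mk_mem_pairsIn {U : Finset V} {u v : V} :
    s(u, v) ∈ pairsIn U ↔ u ∈ U ∧ v ∈ U ∧ u ≠ v := by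
  simp only [pairsIn, Finset.mem_image, Finset.mem_offDiag, Prod.exists, Function.uncurry_apply_pair,
    Sym2.eq_iff]
  constructor
  · rintro ⟨a, b, ⟨ha, hb, hab⟩, ⟨rfl, rfl⟩ | ⟨rfl, rfl⟩⟩
    · exact ⟨ha, hb, hab⟩
    · exact ⟨hb, ha, hab.symm⟩
  · rintro ⟨hu, hv, huv⟩
    exact ⟨u, v, ⟨hu, hv, huv⟩, Or.inl ⟨rfl, rfl⟩⟩

lemma mk_mem_edgesIn {G : SimpleGraph V} {U : Finset V} {u v : V} :
    s(u, v) ∈ edgesIn G U ↔ u ∈ U ∧ v ∈ U ∧ G.Adj u v := by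
  simp only [edgesIn, Finset.mem_filter, mk_mem_pairsIn, SimpleGraph.mem_edgeSet]
  constructor
  · rintro ⟨⟨hu, hv, -⟩, h⟩
    exact ⟨hu, hv, h⟩
  · rintro ⟨hu, hv, h⟩
    exact ⟨⟨hu, hv, h.ne⟩, h⟩

lemma card_pairsIn (U : Finset V) : (pairsIn U).card = U.card.choose 2 :=
  Sym2.card_image_offDiag U

lemma card_edgesIn_insert (G : SimpleGraph V) {A : Finset V} {v : V} (hv : v ∉ A) :
    (edgesIn G A).card + (nbrsIn G v A).card ≤ (edgesIn G (insert v A)).card := by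
  have hinj : Set.InjOn (fun w => s(v, w)) (nbrsIn G v A) := by
    intro a _ b _ h
    exact Sym2.congr_right.1 h
  rw [← Finset.card_image_of_injOn hinj, ← Finset.card_union_of_disjoint]
  · refine Finset.card_le_card (Finset.union_subset ?_ ?_)
    · intro e
      induction e with
      | _ a b =>
        simp only [mk_mem_edgesIn, Finset.mem_insert]
        tauto
    · intro e he
      obtain ⟨w, hw, rfl⟩ := Finset.mem_image.1 he
      rw [mem_nbrsIn] at hw
      rw [mk_mem_edgesIn]
      exact ⟨by simp, by simp [hw.1], hw.2⟩
  · rw [Finset.disjoint_left]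
    intro e he he'
    obtain ⟨w, hw, rfl⟩ := Finset.mem_image.1 he'
    rw [mk_mem_edgesIn] at he
    exact hv he.1

lemma sum_card_nbrsIn_le (G : SimpleGraph V) {S T U : Finset V} (hS : S ⊆ U) (hT : T ⊆ U) :
    ∑ v ∈ T, (nbrsIn G v S).card ≤ 2 * (edgesIn G U).card := by
  rw [← Finset.card_sigma]
  set D := T.sigma fun v => nbrsIn G v S with hD
  let f : (Σ _ : V, V) → Sym2 V := fun x => s(x.1, x.2)
  have himg : D.image f ⊆ edgesIn G U := by
    intro e he
    obtain ⟨⟨a, b⟩, hx, rfl⟩ := Finset.mem_image.1 he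
    rw [hD, Finset.mem_sigma, mem_nbrsIn] at hx
    exact mk_mem_edgesIn.2 ⟨hT hx.1, hS hx.2.1, hx.2.2⟩
  refine (Finset.card_le_mul_card_image (f := f) D 2 ?_).trans
    (Nat.mul_le_mul_left _ (Finset.card_le_card himg))
  intro e _
  induction e with
  | _ a b =>
    have hsub : D.filter (fun x => f x = s(a, b)) ⊆ {⟨a, b⟩, ⟨b, a⟩} := by
      rintro ⟨x, y⟩ hx
      have := (Finset.mem_filter.1 hx).2
      simp only [f, Sym2.eq_iff] at this
      rcases this with ⟨rfl, rfl⟩ | ⟨rfl, rfl⟩ <;> simp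
    exact (Finset.card_le_card hsub).trans Finset.card_le_two

/-- In a graph whose small vertex sets are sparse, a small set `H` can be enlarged to a set `W`
of at most twice its size such that vertices outside `W` have at most `k` neighbors in `W`, and
in every union of components of `G[W]` at least half of the vertices belong to `H`. -/
lemma exists_closure [Fintype V] (G : SimpleGraph V) (H : Finset V) {k m : ℝ} (hk : 0 < k)
    (sparse : ∀ U : Finset V, U.Nonempty → (U.card : ℝ) ≤ m →
      ((edgesIn G U).card : ℝ) < k / 2 * U.card)
    (hm : 2 * (H.card : ℝ) + 1 ≤ m) :
    ∃ W : Finset V, H ⊆ W ∧ W.card ≤ 2 * H.card ∧ (∀ v ∉ W, ((nbrsIn G v W).card : ℝ) ≤ k) ∧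
      ∀ Y ⊆ W, (∀ u ∈ Y, ∀ w ∈ W, G.Adj u w → w ∈ Y) → Y.card ≤ 2 * (Y ∩ H).card := by
  classical
  let P : Finset V → Prop := fun A => H ⊆ A ∧ A.card ≤ 2 * H.card ∧
    ∀ Y ⊆ A, (∀ u ∈ Y, ∀ w ∈ A, G.Adj u w → w ∈ Y) → k * (Y \ H).card ≤ (edgesIn G Y).card
  have hP : P H := by
    refine ⟨subset_rfl, by omega, fun Y hY _ => ?_⟩
    rw [Finset.sdiff_eq_empty_iff_subset.2 hY]
    simp
  have hhalf : ∀ Y : Finset V, (Y.card : ℝ) ≤ m → k * (Y \ H).card ≤ (edgesIn G Y).card →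
      Y.card ≤ 2 * (Y ∩ H).card := by
    intro Y hY h
    rcases Y.eq_empty_or_nonempty with rfl | hne
    · simp
    have h1 := sparse Y hne hY
    have h2 := Finset.card_sdiff_add_card_inter Y H
    have h3 : 2 * ((Y \ H).card : ℝ) < Y.card := by
      by_contra! h4
      nlinarith
    have h4 : 2 * (Y \ H).card < Y.card := by exact_mod_cast h3
    omega
  obtain ⟨W, hW⟩ := Finset.exists_maximal (s := Finset.univ.filter P) ⟨H, by simpa using hP⟩
  have hWP : P W := by simpa using hW.prop
  have hWm : ((W.card : ℕ) : ℝ) + 1 ≤ m := by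
    have : (W.card : ℝ) ≤ 2 * H.card := by exact_mod_cast hWP.2.1
    linarith
  refine ⟨W, hWP.1, hWP.2.1, fun v hv => ?_, fun Y hY hc => ?_⟩
  · by_contra! hlt
    have hvH : v ∉ H := fun h => hv (hWP.1 h)
    have key : ∀ Y ⊆ insert v W, (∀ u ∈ Y, ∀ w ∈ insert v W, G.Adj u w → w ∈ Y) →
        k * (Y \ H).card ≤ (edgesIn G Y).card := by
      intro Y hY hc
      by_cases hvY : v ∈ Y
      · have hYW : Y.erase v ⊆ W := by
          intro x hx
          rw [Finset.mem_erase] at hx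
          exact (Finset.mem_insert.1 (hY hx.2)).resolve_left hx.1
        have h1 := hWP.2.2 (Y.erase v) hYW fun u hu w hw hadj =>
          Finset.mem_erase.2 ⟨fun h => hv (h ▸ hw),
            hc u (Finset.mem_of_mem_erase hu) w (Finset.mem_insert_of_mem hw) hadj⟩
        have h2 := card_edgesIn_insert G (Finset.notMem_erase v Y)
        rw [Finset.insert_erase hvY] at h2
        have h3 : nbrsIn G v W ⊆ nbrsIn G v (Y.erase v) := by
          intro w hw
          rw [mem_nbrsIn] at hw ⊢
          exact ⟨Finset.mem_erase.2 ⟨fun h => hv (h ▸ hw.1),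
            hc v hvY w (Finset.mem_insert_of_mem hw.1) hw.2⟩, hw.2⟩
        have h4 := Finset.card_le_card h3
        have h5 : (Y \ H).card = (Y.erase v \ H).card + 1 := by
          have : Y \ H = insert v (Y.erase v \ H) := by
            ext x
            by_cases hx : x = v
            · simp [hx, hvY, hvH]
            · simp [hx]
          rw [this, Finset.card_insert_of_notMem (by simp)]
        have h6 : ((edgesIn G (Y.erase v)).card : ℝ) + (nbrsIn G v W).card ≤ (edgesIn G Y).card := by
          exact_mod_cast (Nat.add_le_add_left h4 _).trans h2
        rw [h5]
        push_cast
        linarith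
      · refine hWP.2.2 Y (fun x hx => (Finset.mem_insert.1 (hY hx)).resolve_left
          fun h => hvY (h ▸ hx)) fun u hu w hw hadj => hc u hu w (Finset.mem_insert_of_mem hw) hadj
    have hins : P (insert v W) := by
      refine ⟨hWP.1.trans (Finset.subset_insert _ _), ?_, key⟩
      have h1 := hhalf (insert v W)
        (by rw [Finset.card_insert_of_notMem hv]; push_cast; exact hWm)
        (key _ subset_rfl fun u _ w hw _ => hw)
      have h2 := Finset.card_le_card (Finset.inter_subset_right (s₁ := insert v W) (s₂ := H))
      omega
    have := hW.le_of_ge (y := insert v W) (by simpa using hins) (Finset.subset_insert _ _)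
    exact hv (this (Finset.mem_insert_self _ _))
  · refine hhalf Y ?_ (hWP.2.2 Y hY hc)
    have : (Y.card : ℝ) ≤ W.card := by exact_mod_cast Finset.card_le_card hY
    linarith

end SparseGraphs

section Forests

variable {V : Type*} [DecidableEq V]

/-- The non-degenerate pairs `{v, par v}` with `v ∈ Y`. -/
def parentEdges (Y : Finset V) (par : V → V) : Finset (Sym2 V) :=
  (Y.image fun v => s(v, par v)).filter fun e => ¬ e.IsDiag

lemma parentEdges_subset_pairsIn {Y : Finset V} {par : V → V} (h : ∀ v ∈ Y, par v ∈ Y) :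
    parentEdges Y par ⊆ pairsIn Y := by
  intro e he
  obtain ⟨he, hd⟩ := Finset.mem_filter.1 he
  obtain ⟨v, hv, rfl⟩ := Finset.mem_image.1 he
  rw [Sym2.mk_isDiag_iff] at hd
  exact mk_mem_pairsIn.2 ⟨hv, h v hv, hd⟩

/-- A parent function strictly decreasing a height towards a single root gives a spanning tree. -/
lemma card_le_card_parentEdges_add_one {Y : Finset V} {par : V → V} (ρ : V → ℕ) (r : V)
    (h : ∀ v ∈ Y, v ≠ r → ρ (par v) < ρ v) :
    Y.card ≤ (parentEdges Y par).card + 1 := by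
  have hinj : Set.InjOn (fun v => s(v, par v)) (Y.erase r) := by
    intro a ha b hb hab
    simp only [Finset.coe_erase, Set.mem_sdiff, Finset.mem_coe, Set.mem_singleton_iff] at ha hb
    have h1 := h a ha.1 ha.2
    have h2 := h b hb.1 hb.2
    simp only [Sym2.eq_iff] at hab
    rcases hab with ⟨h3, -⟩ | ⟨h3, h4⟩
    · exact h3
    · rw [h4] at h1
      rw [← h3] at h2
      omega
  have hsub : (Y.erase r).image (fun v => s(v, par v)) ⊆ parentEdges Y par := by
    intro e he
    obtain ⟨v, hv, rfl⟩ := Finset.mem_image.1 he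
    rw [Finset.mem_erase] at hv
    refine Finset.mem_filter.2 ⟨Finset.mem_image.2 ⟨v, hv.2, rfl⟩, ?_⟩
    rw [Sym2.mk_isDiag_iff]
    intro heq
    have := h v hv.2 hv.1
    rw [← heq] at this
    exact lt_irrefl _ this
  have h1 := Finset.card_le_card hsub
  rw [Finset.card_image_of_injOn hinj] at h1
  have h2 := Finset.pred_card_le_card_erase (s := Y) (a := r)
  omega

/-- If every component of `G[W]` is a tree with fewer than `L` vertices, then the directed edges
leaving `W` can be ranked so that, along non-backtracking walks, ranks increase. -/
lemma exists_rank [Fintype V] (G : SimpleGraph V) (W : Finset V) (L : ℕ)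
    (htree : ∀ Y ⊆ W, (∀ u ∈ Y, ∀ w ∈ W, G.Adj u w → w ∈ Y) →
      ∀ par : V → V, (∀ v ∈ Y, par v ∈ Y) → (∀ e ∈ parentEdges Y par, e ∈ G.edgeSet) →
      Y.card ≤ (parentEdges Y par).card + 1 →
      Y.card < L ∧ edgesIn G Y ⊆ parentEdges Y par) :
    ∃ rk : V → V → ℕ, (∀ u ∈ W, ∀ v, rk u v ≤ 2 * L + 2) ∧
      ∀ u ∈ W, ∀ v, ∀ w ∈ W, G.Adj u v → G.Adj u w → w ≠ v → rk w u < rk u v := by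
  classical
  let K : SimpleGraph V :=
    { Adj := fun u v => G.Adj u v ∧ u ∈ W ∧ v ∈ W
      symm := ⟨fun u v h => ⟨h.1.symm, h.2.2, h.2.1⟩⟩
      loopless := ⟨fun v h => G.loopless.irrefl v h.1⟩ }
  let root : V → V := fun v => (K.connectedComponentMk v).out
  have hroot : ∀ v, K.Reachable v (root v) := fun v =>
    (SimpleGraph.ConnectedComponent.exact (Quot.out_eq (K.connectedComponentMk v))).symm
  have hroot_eq : ∀ {u v}, K.Reachable u v → root u = root v := fun h =>
    congrArg Quot.out (SimpleGraph.ConnectedComponent.sound h)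
  let ρ : V → ℕ := fun v => K.dist v (root v)
  have hpar : ∀ v, v ≠ root v → ∃ w, K.Adj v w ∧ ρ w < ρ v := by
    intro v hv
    obtain ⟨p, hp⟩ := (hroot v).exists_walk_length_eq_dist
    revert hp
    generalize hr : root v = r at p
    intro hp
    cases p with
    | nil => exact absurd hr.symm hv
    | @cons _ w _ hadj q =>
      refine ⟨w, hadj, ?_⟩
      have h1 : root w = r := by rw [← hr, hroot_eq hadj.reachable]
      have h2 := SimpleGraph.dist_le q
      simp only [ρ, h1, hr]
      rw [SimpleGraph.Walk.length_cons] at hp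
      omega
  let par : V → V := fun v => if h : ∃ w, K.Adj v w ∧ ρ w < ρ v then h.choose else v
  have hparspec : ∀ v, v ≠ root v → K.Adj v (par v) ∧ ρ (par v) < ρ v := by
    intro v hv
    have h := hpar v hv
    simp only [par, dif_pos h]
    exact h.choose_spec
  have hparadj : ∀ v, par v ≠ v → K.Adj v (par v) ∧ ρ (par v) < ρ v := by
    intro v hv
    by_cases h : ∃ w, K.Adj v w ∧ ρ w < ρ v
    · simp only [par, dif_pos h]
      exact h.choose_spec
    · simp [par, dif_neg h] at hv
  have hcomp : ∀ u ∈ W, ρ u < L ∧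
      ∀ w, K.Adj u w → (par u = w ∧ ρ w < ρ u) ∨ (par w = u ∧ ρ u < ρ w) := by
    intro u hu
    let Y : Finset V := W.filter fun w => K.Reachable u w
    have hstep : ∀ a ∈ Y, ∀ b, K.Adj a b → b ∈ Y := by
      intro a ha b hab
      rw [Finset.mem_filter] at ha ⊢
      exact ⟨hab.2.2, ha.2.trans hab.reachable⟩
    have hparY : ∀ v ∈ Y, par v ∈ Y := by
      intro v hv
      by_cases h : par v = v
      · rwa [h]
      · exact hstep v hv _ (hparadj v h).1
    have hYc : ∀ a ∈ Y, ∀ w ∈ W, G.Adj a w → w ∈ Y := fun a ha w hw hadj =>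
      hstep a ha w ⟨hadj, (Finset.mem_filter.1 ha).1, hw⟩
    have hedges : ∀ e ∈ parentEdges Y par, e ∈ G.edgeSet := by
      intro e he
      obtain ⟨he, hd⟩ := Finset.mem_filter.1 he
      obtain ⟨v, hv, rfl⟩ := Finset.mem_image.1 he
      rw [Sym2.mk_isDiag_iff] at hd
      exact (hparadj v (Ne.symm hd)).1.1
    have hcard : Y.card ≤ (parentEdges Y par).card + 1 := by
      refine card_le_card_parentEdges_add_one ρ (root u) fun v hv hne => (hparspec v ?_).2
      rw [hroot_eq (Finset.mem_filter.1 hv).2] at hne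
      exact hne
    obtain ⟨hL, hsub⟩ := htree Y (Finset.filter_subset _ _) hYc par hparY hedges hcard
    refine ⟨?_, ?_⟩
    · obtain ⟨p, hp, hlen⟩ := (hroot u).exists_path_of_dist
      have hsupp : p.support.toFinset ⊆ Y := by
        intro x hx
        rw [List.mem_toFinset] at hx
        have hux : K.Reachable u x := ⟨p.takeUntil x hx⟩
        refine Finset.mem_filter.2 ⟨?_, hux⟩
        obtain ⟨q⟩ := hux.symm
        cases q with
        | nil => exact hu
        | cons h _ => exact h.2.1
      have h1 := Finset.card_le_card hsupp
      rw [List.toFinset_card_of_nodup hp.support_nodup, SimpleGraph.Walk.length_support, hlen] at h1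
      simp only [ρ]
      omega
    · intro w hw
      have huY : u ∈ Y := Finset.mem_filter.2 ⟨hu, SimpleGraph.Reachable.refl u⟩
      have he := hsub (mk_mem_edgesIn.2 ⟨huY, hstep u huY w hw, hw.1⟩)
      obtain ⟨he, hd⟩ := Finset.mem_filter.1 he
      obtain ⟨v, hv, heq⟩ := Finset.mem_image.1 he
      rw [Sym2.mk_isDiag_iff] at hd
      rw [Sym2.eq_iff] at heq
      rcases heq with ⟨rfl, rfl⟩ | ⟨rfl, h2⟩
      · exact Or.inl ⟨rfl, (hparadj v (Ne.symm hd)).2⟩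
      · refine Or.inr ⟨h2, ?_⟩
        have := (hparadj v (by rw [h2]; exact hd)).2
        rwa [h2] at this
  refine ⟨fun u v => if v ∈ W then (if par u = v then L - ρ u else L + ρ u + 1) else 2 * L + 2,
    fun u hu v => ?_, fun u hu v w hw huv huw hne => ?_⟩
  · have := (hcomp u hu).1
    dsimp only
    split_ifs <;> omega
  · have hρu := (hcomp u hu).1
    have hρw := (hcomp w hw).1
    have h1 := (hcomp u hu).2 w ⟨huw, hu, hw⟩
    dsimp only
    rw [if_pos hu]
    by_cases hv : v ∈ W
    · have h2 := (hcomp u hu).2 v ⟨huv, hu, hv⟩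
      rw [if_pos hv]
      rcases h1 with ⟨h1, h1'⟩ | ⟨h1, h1'⟩ <;> rcases h2 with ⟨h2, h2'⟩ | ⟨h2, h2'⟩
      · exact absurd (h1.symm.trans h2) hne
      · have : par u ≠ v := fun h => hne (h1.symm.trans h)
        rw [if_neg this]
        split_ifs <;> omega
      · rw [if_pos h1, if_pos h2]
        omega
      · rw [if_pos h1]
        split_ifs <;> omega
    · rw [if_neg hv]
      split_ifs <;> omega

end Forests

section Dynamics

open Classical in
/-- The Gallager decision made from the color counts `f`. -/
noncomputable def gallagerDecision (f : Fin 3 → ℕ) : Option (Fin 3) :=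
  if ∃ t₁ t₂ : Fin 3, t₁ ≠ t₂ ∧ f t₁ = 0 ∧ f t₂ = 0 then none else some (argminFin3 f)

lemma argminFin3_le (f : Fin 3 → ℕ) (t : Fin 3) : f (argminFin3 f) ≤ f t := by
  unfold argminFin3
  fin_cases t <;> split_ifs <;> simp only [Fin.zero_eta, Fin.mk_one, Fin.reduceFinMk] <;> omega

lemma gallagerDecision_of_lt {f : Fin 3 → ℕ} {t : Fin 3} (h : ∀ s, s ≠ t → f t < f s) :
    gallagerDecision f = some t := by
  unfold gallagerDecision
  rw [if_neg]
  · by_contra hne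
    have h1 : argminFin3 f ≠ t := fun h => hne (congrArg some h)
    exact absurd (argminFin3_le f t) (not_le.2 (h _ h1))
  · rintro ⟨t₁, t₂, hne, h1, h2⟩
    rcases eq_or_ne t₁ t with rfl | h3
    · have := h t₂ hne.symm
      omega
    · have := h t₁ h3
      omega

lemma gallagerDecision_of_zero {f : Fin 3 → ℕ} {t : Fin 3} (h : f t = 0) :
    gallagerDecision f = none ∨ gallagerDecision f = some t := by
  by_cases h' : ∃ s, s ≠ t ∧ f s = 0
  · obtain ⟨s, hs, hs0⟩ := h'
    left
    unfold gallagerDecision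
    rw [if_pos ⟨s, t, hs, hs0, h⟩]
  · right
    push Not at h'
    refine gallagerDecision_of_lt fun s hs => ?_
    have := h' s hs
    omega

variable {V : Type*}

lemma gallagerUpdate_eq (G : SimpleGraph V) (m : V → V → Option (Fin 3)) (u v : V) :
    gallagerUpdate G m u v = gallagerDecision (msgCount G m u v) := rfl

lemma msgCount_congr {G : SimpleGraph V} {m m' : V → V → Option (Fin 3)} {u v : V}
    (h : ∀ w, G.Adj u w → w ≠ v → m w u = m' w u) : msgCount G m u v = msgCount G m' u v := by
  funext t
  unfold msgCount
  congr 1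
  ext w
  simp only [Set.mem_ofPred_eq]
  constructor <;> rintro ⟨h1, h2, h3⟩ <;> have h4 := h w h1 h2
  · exact ⟨h1, h2, by rw [← h4, h3]⟩
  · exact ⟨h1, h2, by rw [h4, h3]⟩

/-- Messages that are correct or undecided never support the correct color of the receiver. -/
lemma msgCount_eq_zero {G : SimpleGraph V} {σ : V → Fin 3} (hσ : ∀ u v, G.Adj u v → σ u ≠ σ v)
    {m : V → V → Option (Fin 3)} {u v : V}
    (h : ∀ w, G.Adj u w → w ≠ v → m w u = none ∨ m w u = some (σ w)) :
    msgCount G m u v (σ u) = 0 := by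
  unfold msgCount
  convert Set.ncard_empty V
  ext w
  simp only [Set.mem_ofPred_eq, Set.mem_empty_iff_false, iff_false, not_and]
  intro h1 h2 h3
  rcases h w h1 h2 with h4 | h4 <;> rw [h4] at h3
  · simp at h3
  · exact hσ u w h1 (Option.some.inj h3).symm

lemma outCount_eq_zero {G : SimpleGraph V} {σ : V → Fin 3} (hσ : ∀ u v, G.Adj u v → σ u ≠ σ v)
    {m : V → V → Option (Fin 3)} {u : V}
    (h : ∀ w, G.Adj u w → m w u = none ∨ m w u = some (σ w)) :
    outCount G m u (σ u) = 0 := by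
  unfold outCount
  convert Set.ncard_empty V
  ext w
  simp only [Set.mem_ofPred_eq, Set.mem_empty_iff_false, iff_false, not_and]
  intro h1 h3
  rcases h w h1 with h4 | h4 <;> rw [h4] at h3
  · simp at h3
  · exact hσ u w h1 (Option.some.inj h3).symm

/-- Once the vertices outside `W` send correct messages forever, and the directed edges leaving
`W` are ranked compatibly with message passing, messages out of `W` settle, after a time
proportional to their rank, to values that are correct or undecided. -/
lemma messages_settle {G : SimpleGraph V} {σ : V → Fin 3} (hσ : ∀ u v, G.Adj u v → σ u ≠ σ v)
    {W : Finset V} {rk : V → V → ℕ}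
    (hrk : ∀ u ∈ W, ∀ v, ∀ w ∈ W, G.Adj u v → G.Adj u w → w ≠ v → rk w u < rk u v)
    {φ : V → Fin 3} {T₀ : ℕ}
    (hcore : ∀ t ≥ T₀, ∀ u ∉ W, ∀ v, G.Adj u v → gallagerIter G φ t u v = some (σ u))
    (k : ℕ) : ∀ u ∈ W, ∀ v, G.Adj u v → rk u v ≤ k → ∀ t ≥ T₀ + 1 + k,
      gallagerIter G φ (t + 1) u v = gallagerIter G φ t u v ∧
        (gallagerIter G φ t u v = none ∨ gallagerIter G φ t u v = some (σ u)) := by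
  induction k using Nat.strong_induction_on with
  | _ k ih =>
    intro u hu v huv hk t ht
    obtain ⟨s, rfl⟩ : ∃ s, t = s + 1 := ⟨t - 1, by omega⟩
    have hin : ∀ w, G.Adj u w → w ≠ v →
        gallagerIter G φ (s + 1) w u = gallagerIter G φ s w u ∧
          (gallagerIter G φ s w u = none ∨ gallagerIter G φ s w u = some (σ w)) := by
      intro w huw hne
      by_cases hw : w ∈ W
      · have hlt := hrk u hu v w hw huv huw hne
        exact ih (rk w u) (by omega) w hw u huw.symm le_rfl s (by omega)
      · have h1 := hcore s (by omega) w hw u huw.symm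
        have h2 := hcore (s + 1) (by omega) w hw u huw.symm
        exact ⟨by rw [h1, h2], Or.inr h1⟩
    refine ⟨?_, ?_⟩
    · change gallagerUpdate G (gallagerIter G φ (s + 1)) u v = gallagerUpdate G (gallagerIter G φ s) u v
      rw [gallagerUpdate_eq, gallagerUpdate_eq, msgCount_congr fun w h1 h2 => (hin w h1 h2).1]
    · exact gallagerDecision_of_zero (msgCount_eq_zero hσ fun w h1 h2 => (hin w h1 h2).2)

end Dynamics

section CoreContraction

variable {V : Type*} [Fintype V]

open Classical in
/-- The vertices outside `W` sending at least one incorrect message in state `m`. -/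
noncomputable def wrongSenders (G : SimpleGraph V) (σ : V → Fin 3) (W : Finset V)
    (m : V → V → Option (Fin 3)) : Finset V :=
  Finset.univ.filter fun u => u ∉ W ∧ ∃ v, G.Adj u v ∧ m u v ≠ some (σ u)

/-- The neighbors of `v` of color `i`. -/
noncomputable def nbrsOfColor (G : SimpleGraph V) (σ : V → Fin 3) (v : V) (i : Fin 3) : Finset V :=
  (nbrsIn G v Finset.univ).filter fun w => σ w = i

lemma mem_nbrsOfColor {G : SimpleGraph V} {σ : V → Fin 3} {v w : V} {i : Fin 3} :
    w ∈ nbrsOfColor G σ v i ↔ G.Adj v w ∧ σ w = i := by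
  simp [nbrsOfColor, mem_nbrsIn]

lemma mem_wrongSenders {G : SimpleGraph V} {σ : V → Fin 3} {W : Finset V}
    {m : V → V → Option (Fin 3)} {u : V} :
    u ∈ wrongSenders G σ W m ↔ u ∉ W ∧ ∃ v, G.Adj u v ∧ m u v ≠ some (σ u) := by
  simp [wrongSenders]

/-- A core vertex sending a wrong message has many neighbors that sent a wrong message in the
previous round. -/
lemma card_nbrsIn_wrongSenders {G : SimpleGraph V} {σ : V → Fin 3}
    (hσ : ∀ u v, G.Adj u v → σ u ≠ σ v) {W : Finset V} {m : V → V → Option (Fin 3)} {a b : ℝ}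
    {u : V} (hdeg : ∀ i, i ≠ σ u → a ≤ (nbrsOfColor G σ u i).card)
    (hW : ((nbrsIn G u W).card : ℝ) ≤ b)
    (hu : u ∈ wrongSenders G σ W (gallagerUpdate G m)) :
    a - 1 - 2 * b ≤ 2 * ((nbrsIn G u (wrongSenders G σ W m)).card : ℝ) := by
  classical
  obtain ⟨huW, v, huv, hne⟩ := mem_wrongSenders.1 hu
  set B := nbrsIn G u (wrongSenders G σ W m) with hB
  have hgood : ∀ w, G.Adj u w → w ∉ nbrsIn G u W → w ∉ B → m w u = some (σ w) := by
    intro w huw hwW hwB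
    by_contra h
    refine hwB (mem_nbrsIn.2 ⟨mem_wrongSenders.2 ⟨?_, u, huw.symm, h⟩, huw⟩)
    exact fun hw => hwW (mem_nbrsIn.2 ⟨hw, huw⟩)
  obtain ⟨s, hs, hle⟩ : ∃ s, s ≠ σ u ∧ msgCount G m u v s ≤ msgCount G m u v (σ u) := by
    by_contra! h
    exact hne (gallagerDecision_of_lt h)
  have h1 : msgCount G m u v (σ u) ≤ (nbrsIn G u W ∪ B).card := by
    rw [← Set.ncard_coe_finset]
    refine Set.ncard_le_ncard ?_ (Finset.finite_toSet _)
    rintro w ⟨huw, -, hw⟩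
    rw [Finset.mem_coe, Finset.mem_union]
    by_contra! h
    rw [hgood w huw h.1 h.2] at hw
    exact hσ u w huw (Option.some.inj hw).symm
  have h2 : (nbrsOfColor G σ u s).card ≤ msgCount G m u v s + (insert v (nbrsIn G u W ∪ B)).card := by
    rw [msgCount, Set.ncard_eq_toFinset_card']
    refine le_trans (Finset.card_le_card ?_) (Finset.card_union_le _ _)
    intro w hw
    rw [mem_nbrsOfColor] at hw
    rw [Finset.mem_union, Set.mem_toFinset, Set.mem_ofPred_eq, Finset.mem_insert]
    by_cases hwv : w = v
    · exact Or.inr (Or.inl hwv)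
    by_cases hw' : w ∈ nbrsIn G u W ∪ B
    · exact Or.inr (Or.inr hw')
    · rw [Finset.mem_union, not_or] at hw'
      exact Or.inl ⟨hw.1, hwv, by rw [hgood w hw.1 hw'.1 hw'.2, hw.2]⟩
  have h3 := Finset.card_insert_le v (nbrsIn G u W ∪ B)
  have h4 := Finset.card_union_le (nbrsIn G u W) B
  have h5 : (nbrsOfColor G σ u s).card ≤ 2 * (nbrsIn G u W).card + 2 * B.card + 1 := by omega
  have h6 : ((nbrsOfColor G σ u s).card : ℝ) ≤ 2 * (nbrsIn G u W).card + 2 * B.card + 1 := by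
    exact_mod_cast h5
  have := hdeg s hs
  linarith

variable [DecidableEq V]

/-- One round of message passing shrinks the set of wrong core senders. -/
lemma card_wrongSenders_update_le {G : SimpleGraph V} {σ : V → Fin 3}
    (hσ : ∀ u v, G.Adj u v → σ u ≠ σ v) {W : Finset V} {m : V → V → Option (Fin 3)} {a b g M : ℝ}
    (hg : 0 < g)
    (hdeg : ∀ u ∉ W, ∀ i, i ≠ σ u → a ≤ (nbrsOfColor G σ u i).card)
    (hW : ∀ u ∉ W, ((nbrsIn G u W).card : ℝ) ≤ b)
    (hab : g * (28 / 3) ≤ a - 1 - 2 * b)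
    (sparse : ∀ U : Finset V, U.Nonempty → (U.card : ℝ) ≤ 2 * M →
      ((edgesIn G U).card : ℝ) < g * U.card)
    (hM : ((wrongSenders G σ W m).card : ℝ) ≤ M) :
    ((wrongSenders G σ W (gallagerUpdate G m)).card : ℝ) ≤ 3 / 4 * (wrongSenders G σ W m).card := by
  set S := wrongSenders G σ W m with hS
  set F := wrongSenders G σ W (gallagerUpdate G m) with hF
  by_contra! hlt
  obtain ⟨T, hTF, hT⟩ : ∃ T ⊆ F, T.card = ⌈(3 / 4 : ℝ) * S.card⌉₊ :=
    Finset.exists_subset_card_eq (Nat.ceil_le.2 hlt.le)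
  have hT1 : (3 / 4 : ℝ) * S.card ≤ T.card := by rw [hT]; exact Nat.le_ceil _
  have hT2 : T.card ≤ S.card := by
    rw [hT, Nat.ceil_le]
    have : (0 : ℝ) ≤ S.card := Nat.cast_nonneg _
    linarith
  have hT2' : (T.card : ℝ) ≤ S.card := by exact_mod_cast hT2
  have hUle : ((S ∪ T).card : ℝ) ≤ S.card + T.card := by exact_mod_cast Finset.card_union_le S T
  rcases (S ∪ T).eq_empty_or_nonempty with hemp | hne
  · have hS0 : S = ∅ := (Finset.union_eq_empty.1 hemp).1
    rw [hS0, Finset.card_empty, Nat.cast_zero, mul_zero, Nat.cast_pos, Finset.card_pos] at hlt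
    obtain ⟨u, hu⟩ := hlt
    have huW : u ∉ W := (mem_wrongSenders.1 hu).1
    have h := card_nbrsIn_wrongSenders hσ (hdeg u huW) (hW u huW) hu
    have h0 : nbrsIn G u (∅ : Finset V) = ∅ := by simp [nbrsIn]
    rw [← hS, hS0, h0, Finset.card_empty, Nat.cast_zero] at h
    linarith
  · have h1 := sparse (S ∪ T) hne (by linarith)
    have h2 := sum_card_nbrsIn_le G (Finset.subset_union_left (s₁ := S) (s₂ := T))
      Finset.subset_union_right
    have h3 : (T.card : ℝ) * (g * (14 / 3)) ≤ ∑ v ∈ T, ((nbrsIn G v S).card : ℝ) := by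
      rw [← nsmul_eq_mul]
      refine Finset.card_nsmul_le_sum _ _ _ fun u hu => ?_
      have huW : u ∉ W := (mem_wrongSenders.1 (hTF hu)).1
      have h := card_nbrsIn_wrongSenders hσ (hdeg u huW) (hW u huW) (hTF hu)
      linarith
    have h4 : ∑ v ∈ T, ((nbrsIn G v S).card : ℝ) ≤ 2 * (edgesIn G (S ∪ T)).card := by
      exact_mod_cast h2
    have h5 : g * (S ∪ T).card ≤ g * (7 / 3 * T.card) :=
      mul_le_mul_of_nonneg_left (by linarith) hg.le
    linarith

lemma card_wrongSenders_iter_le {G : SimpleGraph V} {σ : V → Fin 3}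
    (hσ : ∀ u v, G.Adj u v → σ u ≠ σ v) {W : Finset V} {a b g M : ℝ}
    (hg : 0 < g)
    (hdeg : ∀ u ∉ W, ∀ i, i ≠ σ u → a ≤ (nbrsOfColor G σ u i).card)
    (hW : ∀ u ∉ W, ((nbrsIn G u W).card : ℝ) ≤ b)
    (hab : g * (28 / 3) ≤ a - 1 - 2 * b)
    (sparse : ∀ U : Finset V, U.Nonempty → (U.card : ℝ) ≤ 2 * M →
      ((edgesIn G U).card : ℝ) < g * U.card)
    {φ : V → Fin 3} (hφ : (({v : V | φ v ≠ σ v} : Set V).ncard : ℝ) ≤ M) (t : ℕ) :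
    ((wrongSenders G σ W (gallagerIter G φ t)).card : ℝ) ≤ (3 / 4) ^ t * M := by
  induction t with
  | zero =>
    refine le_trans ?_ (le_of_le_of_eq hφ (by simp))
    rw [← Set.ncard_coe_finset, Nat.cast_le]
    refine Set.ncard_le_ncard ?_ (Set.toFinite _)
    intro u hu
    obtain ⟨-, v, -, h⟩ := mem_wrongSenders.1 (Finset.mem_coe.1 hu)
    exact fun h' => h (congrArg some h')
  | succ t ih =>
    have hM : 0 ≤ M := le_trans (Nat.cast_nonneg _) hφ
    have h1 : ((3 : ℝ) / 4) ^ t ≤ 1 := pow_le_one₀ (by norm_num) (by norm_num)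
    have h2 := card_wrongSenders_update_le hσ hg hdeg hW hab sparse
      (ih.trans (mul_le_of_le_one_left hM h1))
    change ((wrongSenders G σ W (gallagerUpdate G (gallagerIter G φ t))).card : ℝ) ≤ _
    rw [pow_succ]
    linarith

/-- Deterministic convergence: message passing settles on a correct partial coloring when the
vertices outside `W` form a core and `W` spans ranked (tree-like) pieces. -/
lemma gallager_settles {G : SimpleGraph V} {σ : V → Fin 3}
    (hσ : ∀ u v, G.Adj u v → σ u ≠ σ v) {W : Finset V} {a b g M : ℝ}
    (hg : 0 < g) (hb : 0 ≤ b)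
    (hdeg : ∀ u ∉ W, ∀ i, i ≠ σ u → a ≤ (nbrsOfColor G σ u i).card)
    (hW : ∀ u ∉ W, ((nbrsIn G u W).card : ℝ) ≤ b)
    (hab : g * (28 / 3) ≤ a - 1 - 2 * b)
    (sparse : ∀ U : Finset V, U.Nonempty → (U.card : ℝ) ≤ 2 * M →
      ((edgesIn G U).card : ℝ) < g * U.card)
    {rk : V → V → ℕ} {R : ℕ} (hR : ∀ u ∈ W, ∀ v, rk u v ≤ R)
    (hrk : ∀ u ∈ W, ∀ v, ∀ w ∈ W, G.Adj u v → G.Adj u w → w ≠ v → rk w u < rk u v)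
    {φ : V → Fin 3} (hφ : (({v : V | φ v ≠ σ v} : Set V).ncard : ℝ) ≤ M)
    {T₀ : ℕ} (hT₀ : (3 / 4) ^ T₀ * M < 1) :
    (∀ u v, G.Adj u v →
      gallagerIter G φ (T₀ + 1 + R + 1) u v = gallagerIter G φ (T₀ + 1 + R) u v) ∧
    (∀ v ∉ W, gallagerOutput G (gallagerIter G φ (T₀ + 1 + R)) v = some (σ v)) ∧
    (∀ v, gallagerOutput G (gallagerIter G φ (T₀ + 1 + R)) v = none ∨
      gallagerOutput G (gallagerIter G φ (T₀ + 1 + R)) v = some (σ v)) := by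
  have hM : 0 ≤ M := le_trans (Nat.cast_nonneg _) hφ
  have hcore : ∀ t ≥ T₀, ∀ u ∉ W, ∀ v, G.Adj u v → gallagerIter G φ t u v = some (σ u) := by
    intro t ht u hu v huv
    by_contra hne
    have hmem : u ∈ wrongSenders G σ W (gallagerIter G φ t) :=
      mem_wrongSenders.2 ⟨hu, v, huv, hne⟩
    have h1 := card_wrongSenders_iter_le hσ hg hdeg hW hab sparse hφ t
    have h2 : ((3 : ℝ) / 4) ^ t * M ≤ (3 / 4) ^ T₀ * M :=
      mul_le_mul_of_nonneg_right (pow_le_pow_of_le_one (by norm_num) (by norm_num) ht) hM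
    have h3 : (1 : ℝ) ≤ (wrongSenders G σ W (gallagerIter G φ t)).card := by
      exact_mod_cast Finset.card_pos.2 ⟨u, hmem⟩
    linarith
  have hsettle := messages_settle hσ hrk hcore R
  have hmsg : ∀ w u, G.Adj w u → gallagerIter G φ (T₀ + 1 + R) w u = none ∨
      gallagerIter G φ (T₀ + 1 + R) w u = some (σ w) := by
    intro w u hwu
    by_cases hw : w ∈ W
    · exact (hsettle w hw u hwu (hR w hw u) _ le_rfl).2
    · exact Or.inr (hcore _ (by omega) w hw u hwu)
  refine ⟨fun u v huv => ?_, fun v hv => ?_, fun v => ?_⟩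
  · by_cases hu : u ∈ W
    · exact (hsettle u hu v huv (hR u hu v) _ le_rfl).1
    · rw [hcore _ (by omega) u hu v huv, hcore _ (by omega) u hu v huv]
  · refine gallagerDecision_of_lt fun s hs => ?_
    rw [outCount_eq_zero hσ fun w hw => hmsg w v hw.symm]
    have h1 := hdeg v hv s hs
    have h2 := hW v hv
    have h3 : nbrsOfColor G σ v s \ nbrsIn G v W ≠ ∅ := by
      intro h
      have h4 : ((nbrsOfColor G σ v s).card : ℝ) ≤ (nbrsIn G v W).card := by
        exact_mod_cast Finset.card_le_card (Finset.sdiff_eq_empty_iff_subset.1 h)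
      nlinarith
    obtain ⟨w, hw⟩ := Finset.nonempty_iff_ne_empty.2 h3
    rw [Finset.mem_sdiff, mem_nbrsOfColor, mem_nbrsIn] at hw
    have hwW : w ∉ W := fun h => hw.2 ⟨h, hw.1.1⟩
    refine (Set.ncard_pos (Set.toFinite _)).2 ⟨w, hw.1.1, ?_⟩
    rw [hcore _ (by omega) w hwW v hw.1.1.symm, hw.1.2]
  · exact gallagerDecision_of_zero (outCount_eq_zero hσ fun w hw => hmsg w v hw.symm)

end CoreContraction

section PlantedMeasure

lemma not_isDiag_of_bichrom {n : ℕ} {e : Sym2 (Fin n)} (h : Bichrom n e) : ¬ e.IsDiag := by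
  induction e with
  | _ u v =>
    rw [Sym2.mk_isDiag_iff]
    rintro rfl
    exact h rfl

lemma mem_edgeSet_plantedGraph {n : ℕ} {ω : BichromPair n → Bool} {e : Sym2 (Fin n)} :
    e ∈ (plantedGraph n ω).edgeSet ↔ ∃ h : Bichrom n e, ω ⟨e, h⟩ = true := by
  rw [plantedGraph, SimpleGraph.edgeSet_fromEdgeSet]
  constructor
  · rintro ⟨h, -⟩
    exact h
  · rintro ⟨h, h'⟩
    exact ⟨⟨h, h'⟩, not_isDiag_of_bichrom h⟩

lemma plantedColoring_ne_of_adj {n : ℕ} {ω : BichromPair n → Bool} (u v : Fin n)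
    (h : (plantedGraph n ω).Adj u v) : plantedColoring n u ≠ plantedColoring n v :=
  (mem_edgeSet_plantedGraph.1 ((SimpleGraph.mem_edgeSet _).2 h)).1

lemma isProbabilityMeasure_bernoulliMeasure {p : ℝ} (hp0 : 0 ≤ p) (hp1 : p ≤ 1) :
    IsProbabilityMeasure (bernoulliMeasure p) := by
  refine ⟨?_⟩
  simp only [bernoulliMeasure, Measure.coe_add, Measure.coe_smul, Pi.add_apply, Pi.smul_apply,
    measure_univ, smul_eq_mul, mul_one]
  rw [← ENNReal.ofReal_add hp0 (by linarith)]
  simp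

lemma integral_bernoulliMeasure {p : ℝ} (hp0 : 0 ≤ p) (hp1 : p ≤ 1) (f : Bool → ℝ) :
    ∫ b, f b ∂(bernoulliMeasure p) = p * f true + (1 - p) * f false := by
  rw [bernoulliMeasure, integral_add_measure, integral_smul_measure, integral_smul_measure,
    integral_dirac, integral_dirac, ENNReal.toReal_ofReal hp0,
    ENNReal.toReal_ofReal (by linarith : (0 : ℝ) ≤ 1 - p)]
  · simp
  · exact (integrable_dirac (by simp)).smul_measure ENNReal.ofReal_ne_top
  · exact (integrable_dirac (by simp)).smul_measure ENNReal.ofReal_ne_top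

lemma isProbabilityMeasure_plantedMeasure (n : ℕ) {p : ℝ} (hp0 : 0 ≤ p) (hp1 : p ≤ 1) :
    IsProbabilityMeasure (plantedMeasure n p) := by
  have := isProbabilityMeasure_bernoulliMeasure hp0 hp1
  unfold plantedMeasure
  infer_instance

lemma integral_prod_plantedMeasure (n : ℕ) {p : ℝ} (hp0 : 0 ≤ p) (hp1 : p ≤ 1)
    (f : BichromPair n → Bool → ℝ) :
    ∫ ω, ∏ e, f e (ω e) ∂(plantedMeasure n p) = ∏ e, (p * f e true + (1 - p) * f e false) := by
  have := isProbabilityMeasure_bernoulliMeasure hp0 hp1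
  unfold plantedMeasure
  rw [integral_fintype_prod_eq_prod]
  exact Finset.prod_congr rfl fun e _ => integral_bernoulliMeasure hp0 hp1 (f e)

open Classical in
/-- Chernoff bound for the joint event that all pairs of `A` are present and that at most `k`
pairs of the disjoint set `B` are present. -/
lemma plantedMeasure_pairs_le (n : ℕ) {p : ℝ} (hp0 : 0 ≤ p) (hp1 : p ≤ 1)
    {A B : Finset (BichromPair n)} (hAB : Disjoint A B) {l : ℝ} (hl : 0 ≤ l) (k : ℝ) :
    (plantedMeasure n p).real {ω | (∀ e ∈ A, ω e = true) ∧
      ((B.filter fun e => ω e = true).card : ℝ) ≤ k} ≤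
      p ^ A.card * Real.exp (l * k - p * B.card * (1 - Real.exp (-l))) := by
  have := isProbabilityMeasure_plantedMeasure n hp0 hp1
  let f : BichromPair n → Bool → ℝ := fun e b =>
    (if e ∈ A then (if b = true then 1 else 0) else 1) *
      (if e ∈ B then (if b = true then Real.exp (-l) else 1) else 1)
  have hf0 : ∀ e b, 0 ≤ f e b := by
    intro e b
    simp only [f]
    positivity
  set E := {ω : BichromPair n → Bool | (∀ e ∈ A, ω e = true) ∧
      ((B.filter fun e => ω e = true).card : ℝ) ≤ k} with hE
  have hmeas : MeasurableSet E := Set.Finite.measurableSet (Set.toFinite _)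
  have hprod : ∀ ω : BichromPair n → Bool, ∏ e, f e (ω e) = (if ∀ e ∈ A, ω e = true then 1 else 0) *
      Real.exp (-l) ^ (B.filter fun e => ω e = true).card := by
    intro ω
    simp only [f]
    rw [Finset.prod_mul_distrib, Finset.prod_ite_mem, Finset.prod_ite_mem, Finset.univ_inter,
      Finset.univ_inter]
    congr 1
    · split_ifs with h
      · exact Finset.prod_eq_one fun e he => if_pos (h e he)
      · push Not at h
        obtain ⟨e, he, hne⟩ := h
        exact Finset.prod_eq_zero he (if_neg hne)
    · rw [Finset.prod_ite, Finset.prod_const, Finset.prod_const_one, mul_one]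
  have hle : ∀ ω : BichromPair n → Bool, E.indicator (fun _ => (1 : ℝ)) ω ≤ Real.exp (l * k) * ∏ e, f e (ω e) := by
    intro ω
    by_cases h : ω ∈ E
    · rw [Set.indicator_of_mem h, hprod, if_pos h.1, one_mul, ← Real.exp_nat_mul, ← Real.exp_add]
      refine Real.one_le_exp ?_
      nlinarith [h.2]
    · rw [Set.indicator_of_notMem h]
      exact mul_nonneg (Real.exp_pos _).le (Finset.prod_nonneg fun e _ => hf0 e _)
  have h1 : (plantedMeasure n p).real E ≤
      Real.exp (l * k) * ∏ e, (p * f e true + (1 - p) * f e false) := by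
    rw [← integral_prod_plantedMeasure n hp0 hp1, ← integral_const_mul,
      ← integral_indicator_one hmeas]
    exact integral_mono (Integrable.of_finite) (Integrable.of_finite) hle
  have h2 : ∀ e, p * f e true + (1 - p) * f e false =
      (if e ∈ A then p else 1) * (if e ∈ B then 1 - p * (1 - Real.exp (-l)) else 1) := by
    intro e
    have : e ∈ A → e ∉ B := fun h => Finset.disjoint_left.1 hAB h
    simp only [f]
    split_ifs <;> first | (exfalso; tauto) | simp <;> ring
  have h3 : 0 ≤ 1 - p * (1 - Real.exp (-l)) := by
    have : Real.exp (-l) ≤ 1 := Real.exp_le_one_iff.2 (by linarith)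
    have := Real.exp_pos (-l)
    nlinarith
  have h4 : 1 - p * (1 - Real.exp (-l)) ≤ Real.exp (-(p * (1 - Real.exp (-l)))) := by
    have := Real.add_one_le_exp (-(p * (1 - Real.exp (-l))))
    linarith
  refine h1.trans ?_
  rw [Finset.prod_congr rfl fun e _ => h2 e, Finset.prod_mul_distrib, Finset.prod_ite_mem,
    Finset.prod_ite_mem, Finset.univ_inter, Finset.univ_inter, Finset.prod_const,
    Finset.prod_const]
  calc Real.exp (l * k) * (p ^ A.card * (1 - p * (1 - Real.exp (-l))) ^ B.card)
      ≤ Real.exp (l * k) * (p ^ A.card * Real.exp (-(p * (1 - Real.exp (-l)))) ^ B.card) := by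
        gcongr
    _ = p ^ A.card * (Real.exp (l * k) * Real.exp (-(p * (1 - Real.exp (-l)))) ^ B.card) := by ring
    _ = _ := by
        rw [← Real.exp_nat_mul, ← Real.exp_add]
        congr 2
        ring

open Classical in
/-- The same bound in terms of the edge set of the planted graph. -/
lemma plantedMeasure_edges_le (n : ℕ) {p : ℝ} (hp0 : 0 ≤ p) (hp1 : p ≤ 1)
    {A B : Finset (Sym2 (Fin n))} (hAB : Disjoint A B) (hB : ∀ e ∈ B, Bichrom n e)
    {l : ℝ} (hl : 0 ≤ l) (k : ℝ) :
    (plantedMeasure n p).real {ω | (∀ e ∈ A, e ∈ (plantedGraph n ω).edgeSet) ∧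
      ((B.filter fun e => e ∈ (plantedGraph n ω).edgeSet).card : ℝ) ≤ k} ≤
      p ^ A.card * Real.exp (l * k - p * B.card * (1 - Real.exp (-l))) := by
  have := isProbabilityMeasure_plantedMeasure n hp0 hp1
  by_cases hA : ∀ e ∈ A, Bichrom n e
  · have hdisj : Disjoint (A.subtype (Bichrom n)) (B.subtype (Bichrom n)) := by
      rw [Finset.disjoint_left]
      intro e he he'
      rw [Finset.mem_subtype] at he he'
      exact Finset.disjoint_left.1 hAB he he'
    have h := plantedMeasure_pairs_le n hp0 hp1 hdisj hl k
    rw [Finset.card_subtype, Finset.card_subtype, Finset.filter_true_of_mem hA,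
      Finset.filter_true_of_mem hB] at h
    refine le_trans (measureReal_mono ?_ (measure_ne_top _ _)) h
    rintro ω ⟨h1, h2⟩
    refine ⟨fun e he => ?_, le_trans ?_ h2⟩
    · rw [Finset.mem_subtype] at he
      exact (mem_edgeSet_plantedGraph.1 (h1 _ he)).2
    · rw [Nat.cast_le]
      refine Finset.card_le_card_of_injOn Subtype.val ?_ Subtype.val_injective.injOn
      intro e he
      simp only [Finset.coe_filter, Finset.mem_subtype, Set.mem_ofPred_eq] at he ⊢
      exact ⟨he.1, mem_edgeSet_plantedGraph.2 ⟨e.2, he.2⟩⟩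
  · push Not at hA
    obtain ⟨e, he, hne⟩ := hA
    have : {ω | (∀ e ∈ A, e ∈ (plantedGraph n ω).edgeSet) ∧
      ((B.filter fun e => e ∈ (plantedGraph n ω).edgeSet).card : ℝ) ≤ k} = ∅ := by
      ext ω
      simp only [Set.mem_ofPred_eq, Set.mem_empty_iff_false, iff_false, not_and]
      intro h
      exact absurd (mem_edgeSet_plantedGraph.1 (h e he)).1 hne
    rw [this, measureReal_empty]
    positivity

lemma plantedMeasure_edges_present_le (n : ℕ) {p : ℝ} (hp0 : 0 ≤ p) (hp1 : p ≤ 1)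
    (A : Finset (Sym2 (Fin n))) :
    (plantedMeasure n p).real {ω | ∀ e ∈ A, e ∈ (plantedGraph n ω).edgeSet} ≤ p ^ A.card := by
  have h := plantedMeasure_edges_le n hp0 hp1 (Finset.disjoint_empty_right A)
    (by simp) le_rfl (0 : ℝ)
  simpa using h

end PlantedMeasure

section LowDegrees

/-- Each planted color class contains a third of the vertices. -/
lemma le_card_plantedColoring_eq {n : ℕ} (hn : 3 ∣ n) (i : Fin 3) :
    n ≤ 3 * (Finset.univ.filter fun v : Fin n => plantedColoring n v = i).card := by
  obtain ⟨m, rfl⟩ := hn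
  refine Nat.mul_le_mul_left 3 ?_
  have h : (Finset.univ : Finset (Fin m)).card ≤
      (Finset.univ.filter fun v : Fin (3 * m) => plantedColoring (3 * m) v = i).card := by
    refine Finset.card_le_card_of_injOn (fun j => ⟨3 * j + i, by omega⟩) ?_ ?_
    · intro j _
      simp only [Finset.coe_filter, Finset.mem_univ, true_and, Set.mem_ofPred_eq, plantedColoring,
        Fin.ext_iff]
      omega
    · intro j _ j' _ h
      simp only [Fin.mk.injEq] at h
      ext
      omega
  simpa using h

open Classical in
/-- Joint bound for the presence of edges inside `Y` and the shortage, at every vertex of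
`S ⊆ Y`, of neighbors in a prescribed color class. -/
lemma plantedMeasure_edges_low_degree_le {n : ℕ} (hn : 3 ∣ n) {p : ℝ} (hp0 : 0 ≤ p) (hp1 : p ≤ 1)
    {Y S : Finset (Fin n)} (hY : (Y.card : ℝ) ≤ n / 1000) (hS : S ⊆ Y)
    {A : Finset (Sym2 (Fin n))} (hA : A ⊆ pairsIn Y) (i : Fin n → Fin 3) :
    (plantedMeasure n p).real {ω | (∀ e ∈ A, e ∈ (plantedGraph n ω).edgeSet) ∧
      ∀ v ∈ S, i v ≠ plantedColoring n v ∧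
        ((nbrsOfColor (plantedGraph n ω) (plantedColoring n) v (i v)).card : ℝ) <
          3 / 10 * (n * p)} ≤
      p ^ A.card * Real.exp (-(n * p / 2000 * S.card)) := by
  have := isProbabilityMeasure_plantedMeasure n hp0 hp1
  by_cases hi : ∀ v ∈ S, i v ≠ plantedColoring n v
  swap
  · push Not at hi
    obtain ⟨v, hv, hne⟩ := hi
    convert (show (0 : ℝ) ≤ p ^ A.card * Real.exp (-(n * p / 2000 * S.card)) by positivity)
    convert measureReal_empty
    ext ω
    simp only [Set.mem_ofPred_eq, Set.mem_empty_iff_false, iff_false, not_and]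
    exact fun _ h => (h v hv).1 hne
  let D : Finset (Σ _ : Fin n, Fin n) :=
    S.sigma fun v => Finset.univ.filter (fun w => plantedColoring n w = i v) \ Y
  let f : (Σ _ : Fin n, Fin n) → Sym2 (Fin n) := fun x => s(x.1, x.2)
  have hD : ∀ v w : Fin n, (⟨v, w⟩ : Σ _ : Fin n, Fin n) ∈ D ↔
      v ∈ S ∧ plantedColoring n w = i v ∧ w ∉ Y := by
    intro v w
    simp [D]
  have hinj : Set.InjOn f D := by
    rintro ⟨v, w⟩ h ⟨v', w'⟩ h' heq
    rw [Finset.mem_coe, hD] at h h'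
    simp only [f, Sym2.eq_iff] at heq
    rcases heq with ⟨rfl, rfl⟩ | ⟨rfl, rfl⟩
    · rfl
    · exact absurd (hS h'.1) h.2.2
  have hB : ∀ e ∈ D.image f, Bichrom n e := by
    intro e he
    obtain ⟨⟨v, w⟩, h, rfl⟩ := Finset.mem_image.1 he
    rw [hD] at h
    change plantedColoring n v ≠ plantedColoring n w
    rw [h.2.1]
    exact (hi v h.1).symm
  have hdisj : Disjoint A (D.image f) := by
    rw [Finset.disjoint_left]
    intro e he he'
    obtain ⟨⟨v, w⟩, h, rfl⟩ := Finset.mem_image.1 he'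
    rw [hD] at h
    exact h.2.2 (mk_mem_pairsIn.1 (hA he)).2.1
  have hcard : (S.card : ℝ) * (n / 3 - n / 1000) ≤ (D.image f).card := by
    rw [Finset.card_image_of_injOn hinj, Finset.card_sigma, Nat.cast_sum, ← nsmul_eq_mul]
    refine Finset.card_nsmul_le_sum _ _ _ fun v _ => ?_
    have h1 := le_card_plantedColoring_eq hn (i v)
    have h2 := Finset.le_card_sdiff Y (Finset.univ.filter fun w => plantedColoring n w = i v)
    rw [tsub_le_iff_right] at h2
    have h3 : (n : ℝ) ≤ 3 * (Finset.univ.filter fun w : Fin n => plantedColoring n w = i v).card := by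
      exact_mod_cast h1
    have h4 : ((Finset.univ.filter fun w : Fin n => plantedColoring n w = i v).card : ℝ) ≤
        (Finset.univ.filter (fun w => plantedColoring n w = i v) \ Y).card + Y.card := by
      exact_mod_cast h2
    linarith
  refine (measureReal_mono ?_ (measure_ne_top _ _)).trans
    ((plantedMeasure_edges_le n hp0 hp1 hdisj hB (l := 1 / 20) (by norm_num)
      (S.card * (3 / 10 * (n * p)))).trans ?_)
  · rintro ω ⟨h1, h2⟩
    refine ⟨h1, ?_⟩
    have h3 : ((D.image f).filter fun e => e ∈ (plantedGraph n ω).edgeSet).card ≤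
        ∑ v ∈ S, (nbrsOfColor (plantedGraph n ω) (plantedColoring n) v (i v)).card := by
      rw [← Finset.card_sigma]
      refine le_trans (Finset.card_le_card ?_) (Finset.card_image_le (f := f))
      intro e he
      obtain ⟨he, hadj⟩ := Finset.mem_filter.1 he
      obtain ⟨⟨v, w⟩, h, rfl⟩ := Finset.mem_image.1 he
      rw [hD] at h
      refine Finset.mem_image.2 ⟨⟨v, w⟩, ?_, rfl⟩
      rw [Finset.mem_sigma, mem_nbrsOfColor]
      exact ⟨h.1, hadj, h.2.1⟩
    have h4 : (∑ v ∈ S, ((nbrsOfColor (plantedGraph n ω) (plantedColoring n) v (i v)).card : ℝ)) ≤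
        S.card • (3 / 10 * (n * p)) :=
      Finset.sum_le_card_nsmul _ _ _ fun v hv => (h2 v hv).2.le
    rw [nsmul_eq_mul] at h4
    refine le_trans ?_ h4
    exact_mod_cast h3
  · have hexp : Real.exp (-(1 / 20)) ≤ 20 / 21 := by
      rw [Real.exp_neg, inv_le_comm₀ (Real.exp_pos _) (by norm_num)]
      have := Real.add_one_le_exp (1 / 20 : ℝ)
      linarith
    have h1 : p * (S.card * (n / 3 - n / 1000)) * (1 / 21) ≤
        p * (D.image f).card * (1 - Real.exp (-(1 / 20))) := by
      refine mul_le_mul (mul_le_mul_of_nonneg_left hcard hp0) (by linarith) (by norm_num) ?_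
      positivity
    have h2 : 0 ≤ (n : ℝ) * p * S.card := by positivity
    refine mul_le_mul_of_nonneg_left (Real.exp_le_exp.2 ?_) (by positivity)
    nlinarith

open Classical in
/-- The vertices with fewer than `a` neighbors in some color class other than their own. -/
noncomputable def lowDegree {V : Type*} [Fintype V] (G : SimpleGraph V) (σ : V → Fin 3) (a : ℝ) :
    Finset V :=
  Finset.univ.filter fun v => ∃ i, i ≠ σ v ∧ ((nbrsOfColor G σ v i).card : ℝ) < a

lemma mem_lowDegree {V : Type*} [Fintype V] {G : SimpleGraph V} {σ : V → Fin 3} {a : ℝ} {v : V} :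
    v ∈ lowDegree G σ a ↔ ∃ i, i ≠ σ v ∧ ((nbrsOfColor G σ v i).card : ℝ) < a := by
  simp [lowDegree]

/-- The low-degree vertices of the planted graph, with threshold slightly below the mean. -/
noncomputable abbrev plantedLow (n : ℕ) (p : ℝ) (ω : BichromPair n → Bool) : Finset (Fin n) :=
  lowDegree (plantedGraph n ω) (plantedColoring n) (3 / 10 * (n * p))

/-- Joint bound for the presence of edges inside `Y` and at least half of `Y` having low degree. -/
lemma plantedMeasure_edges_half_low_le {n : ℕ} (hn : 3 ∣ n) {p : ℝ} (hp0 : 0 ≤ p) (hp1 : p ≤ 1)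
    {Y : Finset (Fin n)} (hY : (Y.card : ℝ) ≤ n / 1000)
    {A : Finset (Sym2 (Fin n))} (hA : A ⊆ pairsIn Y) :
    (plantedMeasure n p).real {ω | (∀ e ∈ A, e ∈ (plantedGraph n ω).edgeSet) ∧
      Y.card ≤ 2 * (Y ∩ plantedLow n p ω).card} ≤
      p ^ A.card * (6 * Real.exp (-(n * p / 4000))) ^ Y.card := by
  classical
  have := isProbabilityMeasure_plantedMeasure n hp0 hp1
  let ext : (Y → Fin 3) → Fin n → Fin 3 := fun j v => if h : v ∈ Y then j ⟨v, h⟩ else 0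
  let Ev : Finset (Fin n) → (Y → Fin 3) → Set (BichromPair n → Bool) := fun S j =>
    {ω | (∀ e ∈ A, e ∈ (plantedGraph n ω).edgeSet) ∧
      ∀ v ∈ S, ext j v ≠ plantedColoring n v ∧
        ((nbrsOfColor (plantedGraph n ω) (plantedColoring n) v (ext j v)).card : ℝ) <
          3 / 10 * (n * p)}
  let I : Finset (Finset (Fin n) × (Y → Fin 3)) :=
    (Y.powerset.filter fun S => Y.card ≤ 2 * S.card) ×ˢ Finset.univ
  have hsub : {ω | (∀ e ∈ A, e ∈ (plantedGraph n ω).edgeSet) ∧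
      Y.card ≤ 2 * (Y ∩ plantedLow n p ω).card} ⊆ ⋃ x ∈ I, Ev x.1 x.2 := by
    rintro ω ⟨h1, h2⟩
    have hex : ∀ v : Y, ∃ i : Fin 3, v.1 ∈ plantedLow n p ω → i ≠ plantedColoring n v ∧
        ((nbrsOfColor (plantedGraph n ω) (plantedColoring n) v i).card : ℝ) <
          3 / 10 * (n * p) := by
      intro v
      by_cases hv : v.1 ∈ plantedLow n p ω
      · obtain ⟨i, hi⟩ := mem_lowDegree.1 hv
        exact ⟨i, fun _ => hi⟩
      · exact ⟨0, fun h => absurd h hv⟩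
    choose j hj using hex
    simp only [Set.mem_iUnion]
    refine ⟨(Y ∩ plantedLow n p ω, j), ?_, h1, fun v hv => ?_⟩
    · simp [I, h2]
    · rw [Finset.mem_inter] at hv
      simp only [ext, dif_pos hv.1]
      exact hj ⟨v, hv.1⟩ hv.2
  have hbound : ∀ x ∈ I, (plantedMeasure n p).real (Ev x.1 x.2) ≤
      p ^ A.card * Real.exp (-(n * p / 4000)) ^ Y.card := by
    rintro ⟨S, j⟩ hx
    simp only [I, Finset.mem_product, Finset.mem_filter, Finset.mem_powerset, Finset.mem_univ,
      and_true] at hx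
    refine (plantedMeasure_edges_low_degree_le hn hp0 hp1 hY hx.1 hA (ext j)).trans ?_
    refine mul_le_mul_of_nonneg_left ?_ (by positivity)
    rw [← Real.exp_nat_mul, Real.exp_le_exp]
    have h1 : (Y.card : ℝ) ≤ 2 * S.card := by exact_mod_cast hx.2
    have h2 : 0 ≤ (n : ℝ) * p := by positivity
    nlinarith
  have hI : (I.card : ℝ) ≤ 6 ^ Y.card := by
    have h1 : I.card ≤ 2 ^ Y.card * 3 ^ Y.card := by
      rw [Finset.card_product]
      refine Nat.mul_le_mul ((Finset.card_filter_le _ _).trans (by rw [Finset.card_powerset])) ?_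
      simp
    rw [← mul_pow] at h1
    exact_mod_cast h1
  calc _ ≤ (plantedMeasure n p).real (⋃ x ∈ I, Ev x.1 x.2) :=
        measureReal_mono hsub (measure_ne_top _ _)
    _ ≤ ∑ x ∈ I, (plantedMeasure n p).real (Ev x.1 x.2) := measureReal_biUnion_finset_le _ _
    _ ≤ I.card • (p ^ A.card * Real.exp (-(n * p / 4000)) ^ Y.card) :=
        Finset.sum_le_card_nsmul _ _ _ hbound
    _ ≤ 6 ^ Y.card * (p ^ A.card * Real.exp (-(n * p / 4000)) ^ Y.card) := by
        rw [nsmul_eq_mul]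
        gcongr
    _ = _ := by rw [mul_pow]; ring

/-- The number of low-degree vertices is exponentially small with high probability. -/
lemma plantedMeasure_card_low_le {n : ℕ} (hn : 3 ∣ n) (hn0 : 1000 ≤ n) {p : ℝ} (hp0 : 0 ≤ p)
    (hp1 : p ≤ 1) :
    (plantedMeasure n p).real {ω | n * Real.exp (-(n * p / 8000)) ≤ (plantedLow n p ω).card} ≤
      6 * Real.exp (-(n * p / 8000)) := by
  classical
  have := isProbabilityMeasure_plantedMeasure n hp0 hp1
  have hv : ∀ v : Fin n, (plantedMeasure n p).real {ω | v ∈ plantedLow n p ω} ≤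
      6 * Real.exp (-(n * p / 4000)) := by
    intro v
    have h1000 : (1000 : ℝ) ≤ n := by exact_mod_cast hn0
    have h := plantedMeasure_edges_half_low_le hn hp0 hp1 (Y := {v}) (A := ∅)
      (by rw [Finset.card_singleton]; push_cast; linarith) (by simp)
    rw [Finset.card_empty, pow_zero, one_mul, Finset.card_singleton, pow_one] at h
    refine le_trans (measureReal_mono ?_ (measure_ne_top _ _)) h
    intro ω hω
    rw [Set.mem_ofPred_eq] at hω
    refine ⟨by simp, ?_⟩
    rw [Finset.singleton_inter_of_mem hω]
    simp
  have hmean : ∫ ω, ((plantedLow n p ω).card : ℝ) ∂(plantedMeasure n p) ≤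
      n * (6 * Real.exp (-(n * p / 4000))) := by
    have h1 : ∀ ω, ((plantedLow n p ω).card : ℝ) =
        ∑ v : Fin n, Set.indicator {ω | v ∈ plantedLow n p ω} (fun _ => (1 : ℝ)) ω := by
      intro ω
      simp only [Set.indicator_apply, Set.mem_ofPred_eq]
      rw [Finset.sum_ite_mem, Finset.univ_inter]
      simp
    simp_rw [h1]
    rw [integral_finsetSum _ fun _ _ => Integrable.of_finite]
    refine (Finset.sum_le_card_nsmul _ _ (6 * Real.exp (-(n * p / 4000))) fun v _ => ?_).trans ?_
    · refine le_of_eq_of_le ?_ (hv v)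
      exact integral_indicator_one (Set.Finite.measurableSet (Set.toFinite _))
    · simp
  have hmark := mul_meas_ge_le_integral_of_nonneg (μ := plantedMeasure n p)
    (f := fun ω => ((plantedLow n p ω).card : ℝ)) (Filter.Eventually.of_forall fun _ => by simp)
    Integrable.of_finite (n * Real.exp (-(n * p / 8000)))
  have hnpos : (0 : ℝ) < n := by exact_mod_cast (by omega : 0 < n)
  have hpos : 0 < n * Real.exp (-(n * p / 8000)) := mul_pos hnpos (Real.exp_pos _)
  have hsplit : Real.exp (-(n * p / 4000)) = Real.exp (-(n * p / 8000)) * Real.exp (-(n * p / 8000)) := by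
    rw [← Real.exp_add]
    congr 1
    ring
  refine le_of_mul_le_mul_left (hmark.trans (hmean.trans (le_of_eq ?_))) hpos
  rw [hsplit]
  ring

end LowDegrees

section UnionBounds

/-- Union bound over the vertex subsets of size at least `L`, against a geometric series. -/
lemma measureReal_exists_finset_le {Ω V : Type*} [MeasurableSpace Ω] [Fintype V] (μ : Measure Ω)
    [IsFiniteMeasure μ] (E : Finset V → Set Ω) (L : ℕ) {K q : ℝ} (hK : 0 ≤ K) (hq : 0 ≤ q)
    (hq2 : q ≤ 1 / 2)
    (h : ∀ Y : Finset V, L ≤ Y.card →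
      ((Fintype.card V).choose Y.card : ℝ) * μ.real (E Y) ≤ K * q ^ Y.card) :
    μ.real {ω | ∃ Y : Finset V, L ≤ Y.card ∧ ω ∈ E Y} ≤ 2 * K * q ^ L := by
  classical
  let N := Fintype.card V
  let g : ℕ → ℝ := fun y => if L ≤ y then K * q ^ y / N.choose y else 0
  have hsub : {ω | ∃ Y : Finset V, L ≤ Y.card ∧ ω ∈ E Y} ⊆
      ⋃ Y ∈ (Finset.univ : Finset V).powerset.filter (fun Y => L ≤ Y.card), E Y := by
    rintro ω ⟨Y, hY, hω⟩
    simp only [Set.mem_iUnion]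
    exact ⟨Y, by simp [hY], hω⟩
  calc _ ≤ μ.real (⋃ Y ∈ (Finset.univ : Finset V).powerset.filter (fun Y => L ≤ Y.card), E Y) :=
        measureReal_mono hsub (measure_ne_top _ _)
    _ ≤ ∑ Y ∈ (Finset.univ : Finset V).powerset.filter (fun Y => L ≤ Y.card), μ.real (E Y) :=
        measureReal_biUnion_finset_le _ _
    _ ≤ ∑ Y ∈ (Finset.univ : Finset V).powerset, g Y.card := by
        rw [Finset.sum_filter]
        refine Finset.sum_le_sum fun Y _ => ?_
        simp only [g]
        split_ifs with hL
        · have hpos : (0 : ℝ) < N.choose Y.card := by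
            exact_mod_cast Nat.choose_pos (Finset.card_le_univ Y)
          rw [le_div_iff₀ hpos, mul_comm]
          exact h Y hL
        · exact le_rfl
    _ = ∑ y ∈ Finset.range (N + 1), N.choose y • g y := Finset.sum_powerset_apply_card g
    _ ≤ ∑ y ∈ Finset.Ico L (N + 1), K * q ^ y := by
        rw [← Finset.sum_filter_add_sum_filter_not (Finset.range (N + 1)) (fun y => L ≤ y)]
        have h2 : ∑ y ∈ Finset.range (N + 1) with ¬ L ≤ y, N.choose y • g y = 0 := by
          refine Finset.sum_eq_zero fun y hy => ?_
          simp only [g]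
          rw [if_neg (Finset.mem_filter.1 hy).2, smul_zero]
        rw [h2, add_zero]
        have h3 : (Finset.range (N + 1)).filter (fun y => L ≤ y) = Finset.Ico L (N + 1) := by
          ext y
          simp only [Finset.mem_filter, Finset.mem_range, Finset.mem_Ico]
          tauto
        rw [h3]
        refine Finset.sum_le_sum fun y hy => ?_
        rw [Finset.mem_Ico] at hy
        have hpos : (0 : ℝ) < N.choose y := by
          exact_mod_cast Nat.choose_pos (by omega)
        simp only [g]
        rw [if_pos hy.1, nsmul_eq_mul, mul_div_cancel₀ _ hpos.ne']
    _ ≤ K * (q ^ L / (1 - q)) := by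
        rw [← Finset.mul_sum]
        exact mul_le_mul_of_nonneg_left (geom_sum_Ico_le_of_lt_one hq (by linarith)) hK
    _ ≤ _ := by
        rw [mul_comm 2 K, mul_assoc]
        refine mul_le_mul_of_nonneg_left ?_ hK
        rw [div_le_iff₀ (by linarith)]
        nlinarith [pow_nonneg hq L]

lemma choose_mul_pow_le (n u : ℕ) : (n.choose u : ℝ) * u ^ u ≤ (Real.exp 1 * n) ^ u := by
  have h1 : (n.choose u : ℝ) ≤ n ^ u / u.factorial := Nat.choose_le_pow_div u n
  have h2 : (u : ℝ) ^ u / u.factorial ≤ Real.exp u := Real.pow_div_factorial_le_exp _ (by simp) _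
  have h3 : Real.exp u = Real.exp 1 ^ u := by rw [← Real.exp_nat_mul, mul_one]
  calc (n.choose u : ℝ) * u ^ u ≤ n ^ u / u.factorial * u ^ u := by gcongr
    _ = n ^ u * (u ^ u / u.factorial) := by ring
    _ ≤ n ^ u * Real.exp 1 ^ u := by rw [← h3]; gcongr
    _ = _ := by rw [mul_pow, mul_comm]

end UnionBounds

section Sparsity

/-- A fixed vertex set is unlikely to span many edges. -/
lemma plantedMeasure_le_card_edgesIn_le (n : ℕ) {p : ℝ} (hp0 : 0 ≤ p) (hp1 : p ≤ 1)
    (U : Finset (Fin n)) (k : ℕ) :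
    (plantedMeasure n p).real {ω | k ≤ (edgesIn (plantedGraph n ω) U).card} ≤
      (U.card.choose 2).choose k * p ^ k := by
  classical
  have := isProbabilityMeasure_plantedMeasure n hp0 hp1
  have hsub : {ω | k ≤ (edgesIn (plantedGraph n ω) U).card} ⊆
      ⋃ A ∈ (pairsIn U).powersetCard k, {ω | ∀ e ∈ A, e ∈ (plantedGraph n ω).edgeSet} := by
    intro ω hω
    obtain ⟨A, hA, hcard⟩ := Finset.exists_subset_card_eq (Set.mem_ofPred_eq ▸ hω)
    simp only [Set.mem_iUnion]
    refine ⟨A, Finset.mem_powersetCard.2 ⟨fun e he => (Finset.mem_filter.1 (hA he)).1, hcard⟩,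
      fun e he => (Finset.mem_filter.1 (hA he)).2⟩
  refine (measureReal_mono hsub (measure_ne_top _ _)).trans
    ((measureReal_biUnion_finset_le _ _).trans ?_)
  refine (Finset.sum_le_card_nsmul _ _ (p ^ k) fun A hA => ?_).trans ?_
  · rw [← (Finset.mem_powersetCard.1 hA).2]
    exact plantedMeasure_edges_present_le n hp0 hp1 A
  · rw [Finset.card_powersetCard, card_pairsIn, nsmul_eq_mul]

lemma choose_mul_choose_mul_pow_le {n u : ℕ} {p δ γ : ℝ} (hp0 : 0 ≤ p) (hδ : 0 < δ) (hγ : 0 < γ)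
    (hδγ : Real.exp 1 * δ ≤ 8 / 5 * γ) (hd : 1 ≤ γ * (n * p)) (hu : 1 ≤ u) (hun : u ≤ δ * n) :
    (n.choose u : ℝ) * ((u.choose 2).choose ⌈γ * (n * p) * u⌉₊ * p ^ ⌈γ * (n * p) * u⌉₊) ≤
      (Real.exp 1 / δ * Real.exp (-(γ * (n * p) / 5))) ^ u := by
  set k := ⌈γ * (n * p) * u⌉₊ with hk
  have hu' : (1 : ℝ) ≤ u := by exact_mod_cast hu
  have hkγ : γ * (n * p) * u ≤ k := Nat.le_ceil _
  have huk : (u : ℝ) ≤ k := by nlinarith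
  have hn0 : (0 : ℝ) < n := by
    by_contra hcon
    nlinarith
  have hk0 : (0 : ℝ) < k := by linarith
  have hN : ((u.choose 2 : ℕ) : ℝ) ≤ u ^ 2 / 2 := by
    rw [Nat.cast_choose_two]
    nlinarith
  set y : ℝ := u / (δ * n) with hy
  have hy0 : 0 < y := by positivity
  have hy1 : y ≤ 1 := by
    rw [hy, div_le_one (by positivity)]
    exact hun
  have hratio : Real.exp 1 * (u.choose 2 : ℕ) * p / k ≤ y * (4 / 5) := by
    rw [div_le_iff₀ hk0, hy]
    calc Real.exp 1 * (u.choose 2 : ℕ) * p ≤ Real.exp 1 * (u ^ 2 / 2) * p := by gcongr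
      _ = (Real.exp 1 * δ) * (u ^ 2 * p / (2 * δ)) := by field_simp
      _ ≤ (8 / 5 * γ) * (u ^ 2 * p / (2 * δ)) := by gcongr
      _ = u / (δ * n) * (4 / 5) * (γ * (n * p) * u) := by field_simp; ring
      _ ≤ _ := by gcongr
  have h1 : ((u.choose 2).choose k : ℝ) * p ^ k ≤ (y * (4 / 5)) ^ k := by
    refine le_trans ?_ (pow_le_pow_left₀ (by positivity) hratio k)
    rw [div_pow, le_div_iff₀ (by positivity), mul_pow _ p]
    calc ((u.choose 2).choose k : ℝ) * p ^ k * k ^ k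
        = ((u.choose 2).choose k : ℝ) * k ^ k * p ^ k := by ring
      _ ≤ _ := by
        gcongr
        exact choose_mul_pow_le _ _
  have h2 : (n.choose u : ℝ) ≤ (Real.exp 1 / (δ * y)) ^ u := by
    have h := choose_mul_pow_le n u
    have : Real.exp 1 / (δ * y) = Real.exp 1 * n / u := by
      rw [hy]
      field_simp
    rw [this, div_pow, le_div_iff₀ (by positivity)]
    exact h
  have h3 : (y * (4 / 5)) ^ k ≤ y ^ u * Real.exp (-(γ * (n * p) / 5)) ^ u := by
    rw [mul_pow]
    refine mul_le_mul (pow_le_pow_of_le_one hy0.le hy1 (by exact_mod_cast huk)) ?_ (by positivity)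
      (by positivity)
    have h45 : (4 / 5 : ℝ) ≤ Real.exp (-(1 / 5)) := by
      have := Real.add_one_le_exp (-(1 / 5) : ℝ)
      linarith
    refine (pow_le_pow_left₀ (by norm_num) h45 k).trans ?_
    rw [← Real.exp_nat_mul, ← Real.exp_nat_mul, Real.exp_le_exp]
    linarith
  calc _ ≤ (Real.exp 1 / (δ * y)) ^ u * (y ^ u * Real.exp (-(γ * (n * p) / 5)) ^ u) :=
        mul_le_mul h2 (h1.trans h3) (by positivity) (by positivity)
    _ = _ := by
        rw [← mul_pow, ← mul_pow]
        congr 1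
        field_simp

/-- With high probability no small vertex set spans many edges. -/
lemma plantedMeasure_dense_le {n : ℕ} {p δ γ : ℝ} (hp0 : 0 ≤ p) (hp1 : p ≤ 1) (hδ : 0 < δ)
    (hγ : 0 < γ) (hδγ : Real.exp 1 * δ ≤ 8 / 5 * γ) (hd : 1 ≤ γ * (n * p))
    (hq : Real.exp 1 / δ * Real.exp (-(γ * (n * p) / 5)) ≤ 1 / 2) :
    (plantedMeasure n p).real {ω | ∃ U : Finset (Fin n), 1 ≤ U.card ∧ (U.card : ℝ) ≤ δ * n ∧
      γ * (n * p) * U.card ≤ (edgesIn (plantedGraph n ω) U).card} ≤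
      2 * (Real.exp 1 / δ) * Real.exp (-(γ * (n * p) / 5)) := by
  have := isProbabilityMeasure_plantedMeasure n hp0 hp1
  have h := measureReal_exists_finset_le (plantedMeasure n p)
    (fun U : Finset (Fin n) => {ω | (U.card : ℝ) ≤ δ * n ∧
      γ * (n * p) * U.card ≤ (edgesIn (plantedGraph n ω) U).card}) 1 (K := 1) (by norm_num)
    (q := Real.exp 1 / δ * Real.exp (-(γ * (n * p) / 5))) (by positivity) hq ?_
  · refine h.trans (le_of_eq ?_)
    ring
  intro U hU
  by_cases hUn : (U.card : ℝ) ≤ δ * n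
  · rw [one_mul, Fintype.card_fin]
    refine le_trans ?_ (choose_mul_choose_mul_pow_le hp0 hδ hγ hδγ hd hU hUn)
    refine mul_le_mul_of_nonneg_left ?_ (by positivity)
    refine le_trans (measureReal_mono ?_ (measure_ne_top _ _))
      (plantedMeasure_le_card_edgesIn_le n hp0 hp1 U _)
    rintro ω ⟨-, hω⟩
    exact Nat.ceil_le.2 hω
  · have hempty : {ω | (U.card : ℝ) ≤ δ * n ∧
        γ * (n * p) * U.card ≤ (edgesIn (plantedGraph n ω) U).card} = ∅ := by
      ext ω
      simp [hUn]
    rw [hempty, measureReal_empty, mul_zero]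
    positivity

end Sparsity

section SparseTrees

/-- The edge sets of spanning trees of `Y` (and some denser sets) given by parent functions. -/
def parentEdgeSets {V : Type*} [Fintype V] [DecidableEq V] (Y : Finset V) :
    Finset (Finset (Sym2 V)) :=
  (Finset.univ.image (parentEdges Y)).filter fun A =>
    (∃ par : V → V, (∀ v ∈ Y, par v ∈ Y) ∧ A = parentEdges Y par) ∧ Y.card ≤ A.card + 1

lemma mem_parentEdgeSets {V : Type*} [Fintype V] [DecidableEq V] {Y : Finset V}
    {A : Finset (Sym2 V)} :
    A ∈ parentEdgeSets Y ↔
      (∃ par : V → V, (∀ v ∈ Y, par v ∈ Y) ∧ A = parentEdges Y par) ∧ Y.card ≤ A.card + 1 := by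
  rw [parentEdgeSets, Finset.mem_filter]
  refine ⟨fun h => h.2, fun h => ⟨?_, h⟩⟩
  obtain ⟨⟨par, -, rfl⟩, -⟩ := h
  exact Finset.mem_image_of_mem _ (Finset.mem_univ _)

lemma card_parentEdgeSets_le {V : Type*} [Fintype V] [DecidableEq V] (Y : Finset V) :
    (parentEdgeSets Y).card ≤ Y.card ^ Y.card := by
  let ext : (Y → Y) → V → V := fun j v => if h : v ∈ Y then j ⟨v, h⟩ else v
  have hsub : parentEdgeSets Y ⊆ Finset.univ.image fun j : Y → Y => parentEdges Y (ext j) := by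
    intro A hA
    obtain ⟨⟨par, hpar, rfl⟩, -⟩ := mem_parentEdgeSets.1 hA
    refine Finset.mem_image.2 ⟨fun v => ⟨par v, hpar v v.2⟩, Finset.mem_univ _, ?_⟩
    unfold parentEdges
    congr 1
    refine Finset.image_congr fun v hv => ?_
    simp only [ext]
    rw [dif_pos (Finset.mem_coe.1 hv)]
  refine (Finset.card_le_card hsub).trans (Finset.card_image_le.trans ?_)
  simp

lemma plantedMeasure_half_low_exists_le {n : ℕ} (hn : 3 ∣ n) {p : ℝ} (hp0 : 0 ≤ p) (hp1 : p ≤ 1)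
    {Y : Finset (Fin n)} (hY : (Y.card : ℝ) ≤ n / 1000) (F : Finset (Finset (Sym2 (Fin n))))
    (m : ℕ) (hF : ∀ A ∈ F, A ⊆ pairsIn Y ∧ m ≤ A.card) :
    (plantedMeasure n p).real {ω | ∃ A ∈ F, (∀ e ∈ A, e ∈ (plantedGraph n ω).edgeSet) ∧
      Y.card ≤ 2 * (Y ∩ plantedLow n p ω).card} ≤
      F.card * (p ^ m * (6 * Real.exp (-(n * p / 4000))) ^ Y.card) := by
  have := isProbabilityMeasure_plantedMeasure n hp0 hp1
  have hset : {ω | ∃ A ∈ F, (∀ e ∈ A, e ∈ (plantedGraph n ω).edgeSet) ∧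
      Y.card ≤ 2 * (Y ∩ plantedLow n p ω).card} =
      ⋃ A ∈ F, {ω | (∀ e ∈ A, e ∈ (plantedGraph n ω).edgeSet) ∧
        Y.card ≤ 2 * (Y ∩ plantedLow n p ω).card} := by
    ext ω
    simp only [Set.mem_ofPred_eq, Set.mem_iUnion, exists_prop]
  rw [hset, ← nsmul_eq_mul]
  refine (measureReal_biUnion_finset_le _ _).trans (Finset.sum_le_card_nsmul _ _ _ fun A hA => ?_)
  refine (plantedMeasure_edges_half_low_le hn hp0 hp1 hY (hF A hA).1).trans ?_
  exact mul_le_mul_of_nonneg_right (pow_le_pow_of_le_one hp0 hp1 (hF A hA).2) (by positivity)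

/-- Large connected sets with many low-degree vertices are unlikely. -/
lemma plantedMeasure_large_tree_le {n : ℕ} (hn : 3 ∣ n) {p : ℝ} (hp0 : 0 ≤ p) (hp1 : p ≤ 1)
    (hd : 1 ≤ n * p) {L : ℕ} (hL : 1 ≤ L)
    (hq : 12 * Real.exp 1 * (n * p) * Real.exp (-(n * p / 4000)) ≤ 1 / 2) :
    (plantedMeasure n p).real {ω | ∃ Y : Finset (Fin n), L ≤ Y.card ∧ (Y.card : ℝ) ≤ n / 1000 ∧
      ∃ A ∈ parentEdgeSets Y, (∀ e ∈ A, e ∈ (plantedGraph n ω).edgeSet) ∧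
        Y.card ≤ 2 * (Y ∩ plantedLow n p ω).card} ≤
      2 * n * (12 * Real.exp 1 * (n * p) * Real.exp (-(n * p / 4000))) ^ L := by
  have := isProbabilityMeasure_plantedMeasure n hp0 hp1
  refine measureReal_exists_finset_le (plantedMeasure n p)
    (fun Y : Finset (Fin n) => {ω | (Y.card : ℝ) ≤ n / 1000 ∧
      ∃ A ∈ parentEdgeSets Y, (∀ e ∈ A, e ∈ (plantedGraph n ω).edgeSet) ∧
        Y.card ≤ 2 * (Y ∩ plantedLow n p ω).card}) L (by positivity) (by positivity) hq ?_
  intro Y hY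
  rw [Fintype.card_fin]
  by_cases hYn : (Y.card : ℝ) ≤ n / 1000
  swap
  · have hempty : {ω | (Y.card : ℝ) ≤ n / 1000 ∧
      ∃ A ∈ parentEdgeSets Y, (∀ e ∈ A, e ∈ (plantedGraph n ω).edgeSet) ∧
        Y.card ≤ 2 * (Y ∩ plantedLow n p ω).card} = ∅ := by
      ext ω
      simp [hYn]
    rw [hempty, measureReal_empty, mul_zero]
    positivity
  have h1 := plantedMeasure_half_low_exists_le hn hp0 hp1 hYn (parentEdgeSets Y) (Y.card - 1)
    (fun A hA => by
      obtain ⟨⟨par, hpar, rfl⟩, hcard⟩ := mem_parentEdgeSets.1 hA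
      exact ⟨parentEdges_subset_pairsIn hpar, by omega⟩)
  have h2 : ((parentEdgeSets Y).card : ℝ) ≤ (Y.card : ℝ) ^ Y.card := by
    exact_mod_cast card_parentEdgeSets_le Y
  have h3 := choose_mul_pow_le n Y.card
  have h4 : (n : ℝ) ^ Y.card * p ^ (Y.card - 1) ≤ n * (n * p) ^ Y.card := by
    obtain ⟨y, hy⟩ : ∃ y, Y.card = y + 1 := ⟨Y.card - 1, by omega⟩
    rw [hy, Nat.add_sub_cancel]
    calc (n : ℝ) ^ (y + 1) * p ^ y = n * (n * p) ^ y := by rw [mul_pow]; ring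
      _ ≤ _ := by
        exact mul_le_mul_of_nonneg_left (pow_le_pow_right₀ hd (Nat.le_succ y)) (by positivity)
  calc _ ≤ (n.choose Y.card : ℝ) *
        ((Y.card : ℝ) ^ Y.card * (p ^ (Y.card - 1) * (6 * Real.exp (-(n * p / 4000))) ^ Y.card)) := by
        refine mul_le_mul_of_nonneg_left ?_ (by positivity)
        refine le_trans (measureReal_mono (fun ω hω => hω.2) (measure_ne_top _ _)) (h1.trans ?_)
        exact mul_le_mul_of_nonneg_right h2 (by positivity)
    _ = ((n.choose Y.card : ℝ) * (Y.card : ℝ) ^ Y.card) *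
        (p ^ (Y.card - 1) * (6 * Real.exp (-(n * p / 4000))) ^ Y.card) := by ring
    _ ≤ (Real.exp 1 * n) ^ Y.card *
        (p ^ (Y.card - 1) * (6 * Real.exp (-(n * p / 4000))) ^ Y.card) := by gcongr
    _ = (n ^ Y.card * p ^ (Y.card - 1)) *
        (Real.exp 1 * (6 * Real.exp (-(n * p / 4000)))) ^ Y.card := by
        rw [mul_pow, mul_pow (Real.exp 1)]; ring
    _ ≤ (n * (n * p) ^ Y.card) *
        (Real.exp 1 * (6 * Real.exp (-(n * p / 4000)))) ^ Y.card := by gcongr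
    _ = n * (6 * Real.exp 1 * (n * p) * Real.exp (-(n * p / 4000))) ^ Y.card := by
        rw [mul_assoc, ← mul_pow]; ring
    _ ≤ _ := by
        gcongr
        norm_num

/-- Connected sets with a cycle and many low-degree vertices are unlikely. -/
lemma plantedMeasure_cycle_le {n : ℕ} (hn : 3 ∣ n) {p : ℝ} (hp0 : 0 ≤ p) (hp1 : p ≤ 1)
    (hq : 12 * Real.exp 1 * (n * p) * Real.exp (-(n * p / 4000)) ≤ 1 / 2) :
    (plantedMeasure n p).real {ω | ∃ Y : Finset (Fin n), 1 ≤ Y.card ∧ (Y.card : ℝ) ≤ n / 1000 ∧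
      ∃ A ∈ parentEdgeSets Y, ∃ e ∈ pairsIn Y, e ∉ A ∧
        (∀ e' ∈ insert e A, e' ∈ (plantedGraph n ω).edgeSet) ∧
        Y.card ≤ 2 * (Y ∩ plantedLow n p ω).card} ≤
      2 * (12 * Real.exp 1 * (n * p) * Real.exp (-(n * p / 4000))) := by
  have := isProbabilityMeasure_plantedMeasure n hp0 hp1
  have h := measureReal_exists_finset_le (plantedMeasure n p)
    (fun Y : Finset (Fin n) => {ω | (Y.card : ℝ) ≤ n / 1000 ∧
      ∃ A ∈ parentEdgeSets Y, ∃ e ∈ pairsIn Y, e ∉ A ∧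
        (∀ e' ∈ insert e A, e' ∈ (plantedGraph n ω).edgeSet) ∧
        Y.card ≤ 2 * (Y ∩ plantedLow n p ω).card}) 1 (K := 1) (by positivity) (by positivity) hq ?_
  · rwa [mul_one, pow_one] at h
  intro Y hY
  rw [Fintype.card_fin, one_mul]
  by_cases hYn : (Y.card : ℝ) ≤ n / 1000
  swap
  · have hempty : {ω | (Y.card : ℝ) ≤ n / 1000 ∧
      ∃ A ∈ parentEdgeSets Y, ∃ e ∈ pairsIn Y, e ∉ A ∧
        (∀ e' ∈ insert e A, e' ∈ (plantedGraph n ω).edgeSet) ∧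
        Y.card ≤ 2 * (Y ∩ plantedLow n p ω).card} = ∅ := by
      ext ω
      simp [hYn]
    rw [hempty, measureReal_empty, mul_zero]
    positivity
  let F : Finset (Finset (Sym2 (Fin n))) :=
    ((parentEdgeSets Y ×ˢ pairsIn Y).filter fun x => x.2 ∉ x.1).image fun x => insert x.2 x.1
  have h1 := plantedMeasure_half_low_exists_le hn hp0 hp1 hYn F Y.card
    (fun B hB => by
      obtain ⟨⟨A, e⟩, hx, rfl⟩ := Finset.mem_image.1 hB
      rw [Finset.mem_filter, Finset.mem_product] at hx
      obtain ⟨⟨hA, he⟩, hne⟩ := hx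
      obtain ⟨⟨par, hpar, rfl⟩, hcard⟩ := mem_parentEdgeSets.1 hA
      refine ⟨Finset.insert_subset he (parentEdges_subset_pairsIn hpar), ?_⟩
      rwa [Finset.card_insert_of_notMem hne])
  have h2 : (F.card : ℝ) ≤ (Y.card : ℝ) ^ Y.card * 2 ^ Y.card := by
    have : F.card ≤ Y.card ^ Y.card * 2 ^ Y.card := by
      refine Finset.card_image_le.trans ((Finset.card_filter_le _ _).trans ?_)
      rw [Finset.card_product, card_pairsIn]
      exact Nat.mul_le_mul (card_parentEdgeSets_le Y) (Nat.choose_le_two_pow _ _)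
    exact_mod_cast this
  have h3 := choose_mul_pow_le n Y.card
  calc _ ≤ (n.choose Y.card : ℝ) * ((Y.card : ℝ) ^ Y.card * 2 ^ Y.card *
        (p ^ Y.card * (6 * Real.exp (-(n * p / 4000))) ^ Y.card)) := by
        refine mul_le_mul_of_nonneg_left ?_ (by positivity)
        refine le_trans (measureReal_mono ?_ (measure_ne_top _ _)) (h1.trans ?_)
        · rintro ω ⟨-, A, hA, e, he, hne, hE, hlow⟩
          exact ⟨insert e A, Finset.mem_image.2 ⟨(A, e), by simp [hA, he, hne], rfl⟩, hE, hlow⟩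
        · exact mul_le_mul_of_nonneg_right h2 (by positivity)
    _ = ((n.choose Y.card : ℝ) * (Y.card : ℝ) ^ Y.card) *
        (2 ^ Y.card * (p ^ Y.card * (6 * Real.exp (-(n * p / 4000))) ^ Y.card)) := by ring
    _ ≤ (Real.exp 1 * n) ^ Y.card *
        (2 ^ Y.card * (p ^ Y.card * (6 * Real.exp (-(n * p / 4000))) ^ Y.card)) := by gcongr
    _ = _ := by
        rw [← mul_pow, ← mul_pow, ← mul_pow]
        congr 1
        ring

end SparseTrees

section MainTheorem

/-- Deterministic convergence of the Gallager iteration on a sparse graph whose dense part lies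
outside a small forest. -/
lemma gallager_converges {n : ℕ} {p : ℝ} {ω : BichromPair n → Bool} {h : ℝ} {L : ℕ}
    (hd : 100 ≤ n * p)
    (sparse₁ : ∀ U : Finset (Fin n), 1 ≤ U.card → (U.card : ℝ) ≤ 1 / 1000 * n →
      ((edgesIn (plantedGraph n ω) U).card : ℝ) < 1 / 200 * (n * p) * U.card)
    (sparse₂ : ∀ U : Finset (Fin n), 1 ≤ U.card → (U.card : ℝ) ≤ 1 / 60 * n →
      ((edgesIn (plantedGraph n ω) U).card : ℝ) < 57 / 2000 * (n * p) * U.card)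
    (hlow : ((plantedLow n p ω).card : ℝ) ≤ h) (hh : 2 * h + 1 ≤ n / 1000)
    (small : ∀ Y : Finset (Fin n), (Y.card : ℝ) ≤ n / 1000 → ∀ A ∈ parentEdgeSets Y,
      (∀ e ∈ A, e ∈ (plantedGraph n ω).edgeSet) →
      Y.card ≤ 2 * (Y ∩ plantedLow n p ω).card → Y.card < L)
    (acyclic : ∀ Y : Finset (Fin n), (Y.card : ℝ) ≤ n / 1000 → ∀ A ∈ parentEdgeSets Y,
      (∀ e ∈ A, e ∈ (plantedGraph n ω).edgeSet) →
      Y.card ≤ 2 * (Y ∩ plantedLow n p ω).card → edgesIn (plantedGraph n ω) Y ⊆ A)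
    {φ : Fin n → Fin 3}
    (hφ : ({v : Fin n | φ v ≠ plantedColoring n v}.ncard : ℝ) ≤ (n : ℝ) / 120)
    {T₀ : ℕ} (hT₀ : (3 / 4 : ℝ) ^ T₀ * (n / 120) < 1) :
    (∀ u v : Fin n, (plantedGraph n ω).Adj u v →
      gallagerIter (plantedGraph n ω) φ (T₀ + 1 + (2 * L + 2) + 1) u v =
        gallagerIter (plantedGraph n ω) φ (T₀ + 1 + (2 * L + 2)) u v) ∧
    n - 2 * h ≤ ({v : Fin n |
      gallagerOutput (plantedGraph n ω)
        (gallagerIter (plantedGraph n ω) φ (T₀ + 1 + (2 * L + 2))) v =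
          some (plantedColoring n v)}.ncard : ℝ) ∧
    ∀ v : Fin n,
      gallagerOutput (plantedGraph n ω)
        (gallagerIter (plantedGraph n ω) φ (T₀ + 1 + (2 * L + 2))) v = none ∨
      gallagerOutput (plantedGraph n ω)
        (gallagerIter (plantedGraph n ω) φ (T₀ + 1 + (2 * L + 2))) v =
          some (plantedColoring n v) := by
  obtain ⟨W, hHW, hWcard, hWout, hWin⟩ := exists_closure (plantedGraph n ω) (plantedLow n p ω)
    (k := n * p / 100) (m := n / 1000) (by linarith)
    (fun U hU hUn => by
      have := sparse₁ U hU.card_pos (by linarith)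
      linarith)
    (by linarith)
  have hWcard' : (W.card : ℝ) ≤ 2 * (plantedLow n p ω).card := by exact_mod_cast hWcard
  obtain ⟨rk, hR, hrk⟩ := exists_rank (plantedGraph n ω) W L
    (fun Y hYW hclosed par hpar hE hcard => by
      have hYW' : (Y.card : ℝ) ≤ W.card := by exact_mod_cast Finset.card_le_card hYW
      have hYn : (Y.card : ℝ) ≤ n / 1000 := by linarith
      have hA : parentEdges Y par ∈ parentEdgeSets Y := mem_parentEdgeSets.2 ⟨⟨par, hpar, rfl⟩, hcard⟩
      exact ⟨small Y hYn _ hA hE (hWin Y hYW hclosed), acyclic Y hYn _ hA hE (hWin Y hYW hclosed)⟩)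
  obtain ⟨hstable, hcorrect, hor⟩ := gallager_settles
    (fun u v huv => plantedColoring_ne_of_adj u v huv) (W := W) (a := 3 / 10 * (n * p))
    (b := n * p / 100) (g := 57 / 2000 * (n * p)) (M := n / 120) (by linarith) (by linarith)
    (fun u hu i hi => by
      by_contra hlt
      exact hu (hHW (mem_lowDegree.2 ⟨i, hi, not_le.1 hlt⟩)))
    hWout (by linarith) (fun U hU hUn => sparse₂ U hU.card_pos (by linarith)) hR hrk hφ hT₀
  refine ⟨hstable, ?_, hor⟩
  have hsub : ((Finset.univ \ W : Finset (Fin n)) : Set (Fin n)) ⊆ {v : Fin n |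
      gallagerOutput (plantedGraph n ω)
        (gallagerIter (plantedGraph n ω) φ (T₀ + 1 + (2 * L + 2))) v =
          some (plantedColoring n v)} := by
    intro v hv
    exact hcorrect v (Finset.mem_sdiff.1 (Finset.mem_coe.1 hv)).2
  have h1 := Set.ncard_le_ncard hsub (Set.toFinite _)
  rw [Set.ncard_coe_finset] at h1
  have h2 := Finset.le_card_sdiff W (Finset.univ : Finset (Fin n))
  rw [Finset.card_univ, Fintype.card_fin, tsub_le_iff_right] at h2
  have h3 : (n : ℝ) ≤ (Finset.univ \ W : Finset (Fin n)).card + W.card := by exact_mod_cast h2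
  have h4 : ((Finset.univ \ W : Finset (Fin n)).card : ℝ) ≤ ({v : Fin n |
      gallagerOutput (plantedGraph n ω)
        (gallagerIter (plantedGraph n ω) φ (T₀ + 1 + (2 * L + 2))) v =
          some (plantedColoring n v)}.ncard : ℝ) := by exact_mod_cast h1
  linarith

lemma exp_neg_div_le {d : ℝ} (hd : 800000 ≤ d) : Real.exp (-(d / 32000)) ≤ 1 / 14000 := by
  have h := Real.pow_div_factorial_le_exp (d / 32000) (by linarith) 5
  have h1 : (25 : ℝ) ^ 5 ≤ (d / 32000) ^ 5 := pow_le_pow_left₀ (by norm_num) (by linarith) 5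
  rw [show ((5 : ℕ).factorial : ℝ) = 120 by norm_num [Nat.factorial]] at h
  rw [Real.exp_neg, one_div]
  refine inv_anti₀ (by norm_num) ?_
  linarith

lemma mul_exp_neg_div_le {d : ℝ} (hd : 800000 ≤ d) :
    12 * Real.exp 1 * d * Real.exp (-(d / 4000)) ≤ Real.exp (-(d / 8000)) := by
  have h := Real.pow_div_factorial_le_exp (d / 8000) (by linarith) 5
  rw [show ((5 : ℕ).factorial : ℝ) = 120 by norm_num [Nat.factorial]] at h
  have h1 : (100 : ℝ) ^ 4 * (d / 8000) ≤ (d / 8000) ^ 5 := by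
    rw [pow_succ (d / 8000)]
    gcongr
    linarith
  have he := Real.exp_one_lt_d9
  have h2 : 12 * Real.exp 1 * d ≤ Real.exp (d / 8000) := by nlinarith
  have h3 : Real.exp (-(d / 8000)) = Real.exp (d / 8000) * Real.exp (-(d / 4000)) := by
    rw [← Real.exp_add]
    congr 1
    ring
  rw [h3]
  gcongr

lemma natCast_mul_pow_ceil_le {n : ℕ} (hn : 2000 ≤ n) {d q : ℝ} (hd : 8000 ≤ d) (hq0 : 0 ≤ q)
    (hq : q ≤ Real.exp (-(d / 8000))) :
    2 * n * q ^ ⌈2 * Real.log n⌉₊ ≤ 2 * Real.exp (-(d / 16000)) := by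
  have hn0 : (0 : ℝ) < n := by exact_mod_cast (by omega : 0 < n)
  have hlog : 1 ≤ Real.log n := by
    rw [Real.le_log_iff_exp_le hn0]
    have := Real.exp_one_lt_d9
    have h2000 : (2000 : ℝ) ≤ n := by exact_mod_cast hn
    linarith
  have hL := Nat.le_ceil (2 * Real.log n)
  have h1 : q ^ ⌈2 * Real.log n⌉₊ ≤ Real.exp (-(d / 16000) - Real.log n) := by
    refine (pow_le_pow_left₀ hq0 hq _).trans ?_
    rw [← Real.exp_nat_mul, Real.exp_le_exp]
    nlinarith
  calc 2 * n * q ^ ⌈2 * Real.log n⌉₊ ≤ 2 * n * Real.exp (-(d / 16000) - Real.log n) := by gcongr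
    _ = _ := by
      rw [Real.exp_sub, Real.exp_log hn0]
      field_simp

lemma three_quarters_pow_ceil_lt {n : ℕ} (hn : 0 < n) :
    (3 / 4 : ℝ) ^ ⌈4 * Real.log n⌉₊ * (n / 120) < 1 := by
  have hn0 : (0 : ℝ) < n := by exact_mod_cast hn
  have hL := Nat.le_ceil (4 * Real.log n)
  have h1 : (3 / 4 : ℝ) ≤ Real.exp (-(1 / 4)) := by
    have := Real.add_one_le_exp (-(1 / 4) : ℝ)
    linarith
  have h2 : (3 / 4 : ℝ) ^ ⌈4 * Real.log n⌉₊ ≤ (n : ℝ)⁻¹ := by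
    refine (pow_le_pow_left₀ (by norm_num) h1 _).trans ?_
    rw [← Real.exp_nat_mul, ← Real.exp_log (inv_pos.2 hn0), Real.exp_le_exp, Real.log_inv]
    linarith
  calc (3 / 4 : ℝ) ^ ⌈4 * Real.log n⌉₊ * (n / 120) ≤ (n : ℝ)⁻¹ * (n / 120) := by gcongr
    _ = 1 / 120 := by field_simp
    _ < 1 := by norm_num

/-- An event implied by the structural properties of the planted graph has high probability. -/
lemma one_sub_exp_le_plantedMeasure {n : ℕ} (hn : 3 ∣ n) (hn0 : 2000 ≤ n) {p : ℝ} (hp0 : 0 ≤ p)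
    (hp1 : p ≤ 1) (hd : 800000 ≤ n * p) {S : Set (BichromPair n → Bool)}
    (hS : ∀ ω,
      (∀ U : Finset (Fin n), 1 ≤ U.card → (U.card : ℝ) ≤ 1 / 1000 * n →
        ((edgesIn (plantedGraph n ω) U).card : ℝ) < 1 / 200 * (n * p) * U.card) →
      (∀ U : Finset (Fin n), 1 ≤ U.card → (U.card : ℝ) ≤ 1 / 60 * n →
        ((edgesIn (plantedGraph n ω) U).card : ℝ) < 57 / 2000 * (n * p) * U.card) →
      ((plantedLow n p ω).card : ℝ) ≤ n * Real.exp (-(n * p / 8000)) →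
      (∀ Y : Finset (Fin n), (Y.card : ℝ) ≤ n / 1000 → ∀ A ∈ parentEdgeSets Y,
        (∀ e ∈ A, e ∈ (plantedGraph n ω).edgeSet) →
        Y.card ≤ 2 * (Y ∩ plantedLow n p ω).card → Y.card < ⌈2 * Real.log n⌉₊) →
      (∀ Y : Finset (Fin n), (Y.card : ℝ) ≤ n / 1000 → ∀ A ∈ parentEdgeSets Y,
        (∀ e ∈ A, e ∈ (plantedGraph n ω).edgeSet) →
        Y.card ≤ 2 * (Y ∩ plantedLow n p ω).card → edgesIn (plantedGraph n ω) Y ⊆ A) →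
      ω ∈ S) :
    1 - Real.exp (-(n * p / 32000)) ≤ (plantedMeasure n p).real S := by
  have := isProbabilityMeasure_plantedMeasure n hp0 hp1
  have he := Real.exp_one_lt_d9
  set ε := Real.exp (-(n * p / 32000)) with hε
  have hε0 : 0 < ε := Real.exp_pos _
  have hε1 : ε ≤ 1 / 14000 := exp_neg_div_le hd
  have hε2 : Real.exp (-(n * p / 16000)) = ε ^ 2 := by
    rw [hε, ← Real.exp_nat_mul]
    congr 1
    push_cast
    ring
  have hε4 : Real.exp (-(n * p / 8000)) ≤ ε ^ 2 := by
    rw [← hε2, Real.exp_le_exp]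
    linarith
  have hεsq : ε ^ 2 ≤ ε / 14000 := by nlinarith
  have hγ₁ : Real.exp (-(1 / 200 * (n * p) / 5)) ≤ ε ^ 2 := by
    rw [← hε2, Real.exp_le_exp]
    linarith
  have hγ₂ : Real.exp (-(57 / 2000 * (n * p) / 5)) ≤ ε ^ 2 := by
    rw [← hε2, Real.exp_le_exp]
    linarith
  have hb₁ : Real.exp 1 / (1 / 1000) * Real.exp (-(1 / 200 * (n * p) / 5)) ≤ 3000 * ε ^ 2 :=
    mul_le_mul (by linarith) hγ₁ (Real.exp_pos _).le (by norm_num)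
  have hb₂ : Real.exp 1 / (1 / 60) * Real.exp (-(57 / 2000 * (n * p) / 5)) ≤ 180 * ε ^ 2 :=
    mul_le_mul (by linarith) hγ₂ (Real.exp_pos _).le (by norm_num)
  have hq := (mul_exp_neg_div_le hd).trans hε4
  have hlog : 1 ≤ ⌈2 * Real.log n⌉₊ := by
    refine Nat.one_le_ceil_iff.2 (mul_pos two_pos (Real.log_pos ?_))
    exact_mod_cast (by omega : 1 < n)
  have p₁ := plantedMeasure_dense_le (n := n) hp0 hp1 (δ := 1 / 1000) (γ := 1 / 200) (by norm_num)
    (by norm_num) (by linarith) (by linarith) (by linarith)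
  have p₂ := plantedMeasure_dense_le (n := n) hp0 hp1 (δ := 1 / 60) (γ := 57 / 2000) (by norm_num)
    (by norm_num) (by linarith) (by linarith) (by linarith)
  have p₃ := plantedMeasure_card_low_le hn (by omega) hp0 hp1
  have p₄ := (plantedMeasure_large_tree_le hn hp0 hp1 (by linarith) hlog (by linarith)).trans
    (natCast_mul_pow_ceil_le hn0 (by linarith) (by positivity) (mul_exp_neg_div_le hd))
  have p₅ := plantedMeasure_cycle_le hn hp0 hp1 (by linarith)
  set B₁ := {ω | ∃ U : Finset (Fin n), 1 ≤ U.card ∧ (U.card : ℝ) ≤ 1 / 1000 * n ∧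
      1 / 200 * (n * p) * U.card ≤ (edgesIn (plantedGraph n ω) U).card} with hB₁
  set B₂ := {ω | ∃ U : Finset (Fin n), 1 ≤ U.card ∧ (U.card : ℝ) ≤ 1 / 60 * n ∧
      57 / 2000 * (n * p) * U.card ≤ (edgesIn (plantedGraph n ω) U).card} with hB₂
  set B₃ := {ω | n * Real.exp (-(n * p / 8000)) ≤ (plantedLow n p ω).card} with hB₃
  set B₄ := {ω | ∃ Y : Finset (Fin n), ⌈2 * Real.log n⌉₊ ≤ Y.card ∧ (Y.card : ℝ) ≤ n / 1000 ∧
      ∃ A ∈ parentEdgeSets Y, (∀ e ∈ A, e ∈ (plantedGraph n ω).edgeSet) ∧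
        Y.card ≤ 2 * (Y ∩ plantedLow n p ω).card} with hB₄
  set B₅ := {ω | ∃ Y : Finset (Fin n), 1 ≤ Y.card ∧ (Y.card : ℝ) ≤ n / 1000 ∧
      ∃ A ∈ parentEdgeSets Y, ∃ e ∈ pairsIn Y, e ∉ A ∧
        (∀ e' ∈ insert e A, e' ∈ (plantedGraph n ω).edgeSet) ∧
        Y.card ≤ 2 * (Y ∩ plantedLow n p ω).card} with hB₅
  have hcover : (Set.univ : Set (BichromPair n → Bool)) ⊆ S ∪ (B₁ ∪ (B₂ ∪ (B₃ ∪ (B₄ ∪ B₅)))) := by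
    intro ω _
    by_contra hω
    simp only [Set.mem_union, not_or] at hω
    obtain ⟨hωS, h₁, h₂, h₃, h₄, h₅⟩ := hω
    refine hωS (hS ω ?_ ?_ ?_ ?_ ?_)
    · intro U hU hUn
      by_contra hlt
      exact h₁ ⟨U, hU, hUn, not_lt.1 hlt⟩
    · intro U hU hUn
      by_contra hlt
      exact h₂ ⟨U, hU, hUn, not_lt.1 hlt⟩
    · by_contra hlt
      exact h₃ (not_le.1 hlt).le
    · intro Y hY A hA hE hlow
      by_contra hlt
      exact h₄ ⟨Y, not_lt.1 hlt, hY, A, hA, hE, hlow⟩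
    · intro Y hY A hA hE hlow e he
      by_contra hne
      classical
      obtain ⟨heY, heG⟩ := Finset.mem_filter.1 he
      have hcard : 1 ≤ Y.card := by
        have hpos := Finset.card_pos.2 ⟨e, heY⟩
        rw [card_pairsIn] at hpos
        by_contra h0
        rw [show Y.card = 0 by omega] at hpos
        simp at hpos
      refine h₅ ⟨Y, hcard, hY, A, hA, e, heY, hne, ?_, hlow⟩
      intro e' he'
      rcases Finset.mem_insert.1 he' with rfl | he'
      · exact heG
      · exact hE e' he'
  have hmono := measureReal_mono (μ := plantedMeasure n p) hcover (measure_ne_top _ _)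
  rw [probReal_univ] at hmono
  have u₀ := measureReal_union_le (μ := plantedMeasure n p) S (B₁ ∪ (B₂ ∪ (B₃ ∪ (B₄ ∪ B₅))))
  have u₁ := measureReal_union_le (μ := plantedMeasure n p) B₁ (B₂ ∪ (B₃ ∪ (B₄ ∪ B₅)))
  have u₂ := measureReal_union_le (μ := plantedMeasure n p) B₂ (B₃ ∪ (B₄ ∪ B₅))
  have u₃ := measureReal_union_le (μ := plantedMeasure n p) B₃ (B₄ ∪ B₅)
  have u₄ := measureReal_union_le (μ := plantedMeasure n p) B₄ B₅
  rw [hε2] at p₄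
  linarith

end MainTheorem

/-- Gallager on the planted model, started from a coloring at distance at most
`n/120` from the planted one, converges in `O(log n)` iterations to a partial coloring that
agrees with the planted one on all assigned vertices, assigns at least `(1 - e^{-cnp})n`
vertices, leaves the rest Undecided, and the coloring extends to a proper 3-coloring. -/
theorem gallager_on_planted_model :
    ∃ C0 c C : ℝ, ∃ N : ℕ, 0 < C0 ∧ 0 < c ∧ 0 < C ∧
      ∀ n : ℕ, N ≤ n → 3 ∣ n → ∀ p : ℝ, 0 ≤ p → p ≤ 1 → C0 ≤ n * p →
        ENNReal.ofReal (1 - Real.exp (-(c * n * p))) ≤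
          plantedMeasure n p {ω : BichromPair n → Bool |
            ∀ φ : Fin n → Fin 3,
              ({v : Fin n | φ v ≠ plantedColoring n v}.ncard : ℝ) ≤ (n : ℝ) / 120 →
              ∃ T : ℕ, (T : ℝ) ≤ C * Real.log n ∧
                -- convergence at iteration T
                (∀ u v : Fin n, (plantedGraph n ω).Adj u v →
                    gallagerIter (plantedGraph n ω) φ (T + 1) u v =
                      gallagerIter (plantedGraph n ω) φ T u v) ∧
                -- |V_A| ≥ (1 - e^{-Θ(np)}) n
                (1 - Real.exp (-(c * n * p))) * n ≤
                  ({v : Fin n |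
                    gallagerOutput (plantedGraph n ω) (gallagerIter (plantedGraph n ω) φ T) v =
                      some (plantedColoring n v)}.ncard : ℝ) ∧
                -- all vertices outside V_A are Undecided
                (∀ v : Fin n,
                    gallagerOutput (plantedGraph n ω) (gallagerIter (plantedGraph n ω) φ T) v ≠
                      some (plantedColoring n v) →
                    gallagerOutput (plantedGraph n ω) (gallagerIter (plantedGraph n ω) φ T) v =
                      none) ∧
                -- the partial coloring extends to a proper 3-coloring of G
                (∃ ψ : Fin n → Fin 3,
                    (∀ u v : Fin n, (plantedGraph n ω).Adj u v → ψ u ≠ ψ v) ∧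
                    ∀ v : Fin n,
                      gallagerOutput (plantedGraph n ω) (gallagerIter (plantedGraph n ω) φ T) v =
                        some (plantedColoring n v) → ψ v = plantedColoring n v)} := by
  refine ⟨800000, 1 / 32000, 17, 2000, by norm_num, by norm_num, by norm_num, ?_⟩
  intro n hn0 hn p hp0 hp1 hd
  have := isProbabilityMeasure_plantedMeasure n hp0 hp1
  have hn2000 : (2000 : ℝ) ≤ n := by exact_mod_cast hn0
  have hε1 := exp_neg_div_le hd
  have hε : Real.exp (-(n * p / 8000)) ≤ Real.exp (-(n * p / 32000)) / 2 := by
    have h1 : Real.exp (-(n * p / 8000)) ≤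
        Real.exp (-(n * p / 32000)) * Real.exp (-(n * p / 32000)) := by
      rw [← Real.exp_add, Real.exp_le_exp]
      linarith
    nlinarith [Real.exp_pos (-(n * p / 32000))]
  rw [show 1 / 32000 * (n : ℝ) * p = n * p / 32000 by ring]
  refine ENNReal.ofReal_le_of_le_toReal
    (one_sub_exp_le_plantedMeasure hn hn0 hp0 hp1 hd fun ω h₁ h₂ h₃ h₄ h₅ φ hφ => ?_)
  obtain ⟨hstable, hcard, hor⟩ := gallager_converges (by linarith) h₁ h₂ h₃ (by nlinarith) h₄ h₅ hφ
    (three_quarters_pow_ceil_lt (by omega))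
  refine ⟨_, ?_, hstable, ?_, fun v hv => (hor v).resolve_right hv, plantedColoring n,
    fun u v huv => plantedColoring_ne_of_adj u v huv, fun v _ => rfl⟩
  · have hlog : 1 ≤ Real.log n := by
      rw [Real.le_log_iff_exp_le (by linarith)]
      linarith [Real.exp_one_lt_d9]
    have h4 := Nat.ceil_lt_add_one (a := 4 * Real.log n) (by linarith)
    have h2 := Nat.ceil_lt_add_one (a := 2 * Real.log n) (by linarith)
    push_cast
    linarith
  · refine le_trans ?_ hcard
    nlinarith
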